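/- arXiv:math/0001049 — 6 statements merged into one kernel-verified Lean document; each statement's English description precedes it below -/
import Mathlib

section
/- Let K be a field and S a positive normal affine semigroup with gp(S) = ℤ^r and support forms σ_1,…,σ_s. There exists a constant M > 0, depending only on S, with the following property: for every a ∈ ℤ^s with T(a) ≠ ∅ and all points p, q ∈ ℝ^r such that the segment [p,q] is a face (i.e. an extreme subset) of the polyhedron C(a) = {x ∈ ℝ^r : σ_i(x) ≥ a_i, i = 1,…,s}, one has μ(D(a)) ≥ M·‖p − q‖, where ‖·‖ is the Euclidean norm on ℝ^r. -/
set_option synthInstance.maxHeartbeats 1000000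
set_option maxHeartbeats 1000000

open scoped BigOperators

noncomputable section

/-- Pairing of an integral linear form (given by its coefficient vector `f`) with `x`. -/
def lin {r : ℕ} (f x : Fin r → ℤ) : ℤ := ∑ k, f k * x k

lemma lin_zero {r : ℕ} (f : Fin r → ℤ) : lin f 0 = 0 := by simp [lin]

lemma lin_add {r : ℕ} (f x y : Fin r → ℤ) : lin f (x + y) = lin f x + lin f y := by
  simp [lin, mul_add, Finset.sum_add_distrib]

/-- A family of integral linear forms, bundled as an additive homomorphism `ℤ^r → ℤ^s`. -/
def formsHom {r s : ℕ} (σ : Fin s → Fin r → ℤ) : (Fin r → ℤ) →+ (Fin s → ℤ) where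
  toFun x i := lin (σ i) x
  map_zero' := by funext i; simp [lin_zero]
  map_add' x y := by funext i; simp [lin_add]

/-- The subgroup `σ(ℤ^r) ⊆ ℤ^s`. -/
def formsRange {r s : ℕ} (σ : Fin s → Fin r → ℤ) : AddSubgroup (Fin s → ℤ) :=
  (formsHom σ).range

/-- The divisor class group `Cl(R) = ℤ^s / σ(ℤ^r)`. -/
abbrev classGroup {r s : ℕ} (σ : Fin s → Fin r → ℤ) : Type :=
  (Fin s → ℤ) ⧸ formsRange σ

/-- The set of solutions of the inhomogeneous system of inequalities `σ_i(x) ≥ a_i`. -/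
def Tset {r s : ℕ} (σ : Fin s → Fin r → ℤ) (a : Fin s → ℤ) : Set (Fin r → ℤ) :=
  {x | ∀ i, a i ≤ lin (σ i) x}

section Polyhedron

variable {ι E : Type*} [NormedAddCommGroup E] [NormedSpace ℝ E]

/-- If the constraints active at `m` do not decrease in direction `w`, a short step from `m` in
direction `w` stays in the polyhedron. -/
lemma exists_pos_step [Finite ι] {L : ι → E →L[ℝ] ℝ} {a : ι → ℝ} {m w : E}
    (hm : ∀ i, a i ≤ L i m) (hw : ∀ i, L i m = a i → 0 ≤ L i w) :
    ∃ ε : ℝ, 0 < ε ∧ ∀ i, a i ≤ L i (m + ε • w) := by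
  have key : ∀ᶠ ε in nhdsWithin (0 : ℝ) (Set.Ioi 0), ∀ i, a i ≤ L i (m + ε • w) := by
    refine Filter.eventually_all.2 fun i => ?_
    rcases (hm i).eq_or_lt with h | h
    · filter_upwards [self_mem_nhdsWithin] with ε hε
      have := mul_nonneg (le_of_lt (Set.mem_Ioi.1 hε)) (hw i h.symm)
      simp only [map_add, map_smul, smul_eq_mul]
      linarith
    · have hc : Continuous fun ε : ℝ => L i (m + ε • w) := by fun_prop
      have h0 : a i < L i (m + (0 : ℝ) • w) := by simpa using h
      exact ((hc.continuousAt.eventually (lt_mem_nhds h0)).filter_mono nhdsWithin_le_nhds).mono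
        fun _ h => h.le
  obtain ⟨ε, h, hε⟩ := (key.and self_mem_nhdsWithin).exists
  exact ⟨ε, hε, h⟩

/-- At the endpoint `p` of a nondegenerate segment that is a face of a polyhedron, some active
constraint strictly increases in the direction of the segment. -/
lemma exists_active_pos_of_isExtreme_segment [Finite ι] {L : ι → E →L[ℝ] ℝ} {a : ι → ℝ}
    {p q : E} (hpq : p ≠ q) (hE : IsExtreme ℝ {x | ∀ i, a i ≤ L i x} (segment ℝ p q)) :
    ∃ i, L i p = a i ∧ 0 < L i (q - p) := by
  by_contra! hcon
  have hp := hE.1 (left_mem_segment ℝ p q)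
  have hq := hE.1 (right_mem_segment ℝ p q)
  obtain ⟨ε, hε, hx⟩ := exists_pos_step (w := p - q) hp fun i hi => by
    have := hcon i hi
    simp only [map_sub] at this ⊢
    linarith
  have hmem : p ∈ openSegment ℝ (p + ε • (p - q)) q := by
    refine ⟨1 / (1 + ε), ε / (1 + ε), by positivity, by positivity, by field_simp, ?_⟩
    match_scalars <;> field_simp
    ring
  have := hE.left_mem_of_mem_openSegment hx hq (left_mem_segment ℝ p q) hmem
  rw [segment_eq_image'] at this
  obtain ⟨θ, hθ, h⟩ := this
  have h' : (θ + ε) • (q - p) = 0 := by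
    dsimp only at h
    rw [← sub_eq_zero.2 h]
    module
  rcases smul_eq_zero.1 h' with h | h
  · linarith [hθ.1]
  · exact hpq (sub_eq_zero.1 h).symm

/-- A direction along which the constraints active on the whole segment are constant and those
active at an endpoint do not increase is trivial. -/
lemma eq_zero_of_isExtreme_segment [Finite ι] {L : ι → E →L[ℝ] ℝ} {a : ι → ℝ} {p q w : E}
    (hpq : p ≠ q) (hE : IsExtreme ℝ {x | ∀ i, a i ≤ L i x} (segment ℝ p q))
    (hI : ∀ i, L i p = a i ∧ L i q = a i → L i w = 0)
    (hJ : ∀ i, L i p = a i ∨ L i q = a i → L i w ≤ 0) : w = 0 := by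
  have hp := hE.1 (left_mem_segment ℝ p q)
  have hq := hE.1 (right_mem_segment ℝ p q)
  have hmid := midpoint_mem_segment (𝕜 := ℝ) p q
  have hm := hE.1 hmid
  have hact : ∀ i, L i (midpoint ℝ p q) = a i → L i w = 0 := by
    intro i hi
    have h1 := hp i
    have h2 := hq i
    have h3 : L i (midpoint ℝ p q) = (L i p + L i q) / 2 := by
      simp [midpoint_eq_smul_add]
      ring
    exact hI i ⟨by linarith, by linarith⟩
  obtain ⟨ε, hε, hx⟩ := exists_pos_step hm fun i hi => (hact i hi).ge
  obtain ⟨δ, hδ, hy⟩ := exists_pos_step (w := -w) hm fun i hi => by simp [hact i hi]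
  have hmem : midpoint ℝ p q ∈
      openSegment ℝ (midpoint ℝ p q + ε • w) (midpoint ℝ p q + δ • -w) := by
    refine ⟨δ / (ε + δ), ε / (ε + δ), by positivity, by positivity, by field_simp; ring, ?_⟩
    match_scalars <;> field_simp <;> ring
  have := hE.left_mem_of_mem_openSegment hx hy hmid hmem
  rw [segment_eq_image'] at this
  obtain ⟨θ, -, h⟩ := this
  dsimp only at h
  have hw : w = ((θ - 1 / 2) / ε) • (q - p) := by
    have h' : ε • w = (θ - 1 / 2) • (q - p) := by
      rw [midpoint_eq_smul_add, invOf_eq_inv] at h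
      rw [← sub_eq_zero, ← sub_eq_zero.2 h.symm]
      module
    rw [div_eq_inv_mul, mul_smul, ← h', inv_smul_smul₀ hε.ne']
  rcases lt_trichotomy ((θ - 1 / 2) / ε) 0 with ht | ht | ht
  · obtain ⟨i, hi, hpos⟩ := exists_active_pos_of_isExtreme_segment hpq.symm
      (segment_symm ℝ p q ▸ hE)
    have := hJ i (Or.inr hi)
    rw [hw, map_smul, smul_eq_mul, ← neg_sub p q, map_neg] at this
    nlinarith
  · rw [hw, ht, zero_smul]
  · obtain ⟨i, hi, hpos⟩ := exists_active_pos_of_isExtreme_segment hpq hE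
    have := hJ i (Or.inl hi)
    rw [hw, map_smul, smul_eq_mul] at this
    nlinarith

/-- A polyhedron with trivial recession cone is bounded. -/
lemma exists_norm_le_of_recession_trivial [FiniteDimensional ℝ E] (L : ι → E →L[ℝ] ℝ)
    (I J : Finset ι) (B : ℝ)
    (h : ∀ w, (∀ i ∈ I, L i w = 0) → (∀ j ∈ J, L j w ≤ 0) → w = 0) :
    ∃ D : ℝ, ∀ w, (∀ i ∈ I, |L i w| ≤ B) → (∀ j ∈ J, L j w ≤ B) → ‖w‖ ≤ D := by
  have : ProperSpace E := FiniteDimensional.proper ℝ E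
  let f : E → ℝ := fun w => ∑ i ∈ I, |L i w| + ∑ j ∈ J, max (L j w) 0
  have hf : Continuous f := by fun_prop
  have hI0 : ∀ w, ∀ i ∈ I, 0 ≤ |L i w| := fun _ _ _ => abs_nonneg _
  have hJ0 : ∀ w, ∀ j ∈ J, 0 ≤ max (L j w) 0 := fun _ _ _ => le_max_right _ _
  have hpos : ∀ w ∈ Metric.sphere (0 : E) 1, 0 < f w := by
    intro w hw
    have h1 := Finset.sum_nonneg (hI0 w)
    have h2 := Finset.sum_nonneg (hJ0 w)
    refine lt_of_le_of_ne (add_nonneg h1 h2) fun h0 => ?_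
    have h0' : ∑ i ∈ I, |L i w| + ∑ j ∈ J, max (L j w) 0 = 0 := h0.symm
    have hs1 := (Finset.sum_eq_zero_iff_of_nonneg (hI0 w)).1 (by linarith)
    have hs2 := (Finset.sum_eq_zero_iff_of_nonneg (hJ0 w)).1 (by linarith)
    have hw0 : w = 0 := h w (fun i hi => abs_eq_zero.1 (hs1 i hi))
      fun j hj => (le_max_left _ _).trans (hs2 j hj).le
    simp [hw0] at hw
  obtain ⟨c, hc, hcf⟩ := (isCompact_sphere (0 : E) 1).exists_forall_le' hf.continuousOn hpos
  have hhom : ∀ w, c * ‖w‖ ≤ f w := by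
    intro w
    rcases eq_or_ne w 0 with rfl | hw
    · simp [f]
    have hn : 0 < ‖w‖ := norm_pos_iff.2 hw
    have h1 := hcf (‖w‖⁻¹ • w) (by simp [norm_smul, hn.ne'])
    have h2 : f (‖w‖⁻¹ • w) = ‖w‖⁻¹ * f w := by
      have hi : 0 ≤ ‖w‖⁻¹ := by positivity
      simp only [f, map_smul, smul_eq_mul, abs_mul, abs_of_nonneg hi, mul_add, Finset.mul_sum,
        mul_max_of_nonneg _ _ hi, mul_zero]
    rw [h2, inv_mul_eq_div, le_div_iff₀ hn] at h1
    exact h1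
  refine ⟨(I.card * |B| + J.card * |B|) / c, fun w hwI hwJ => ?_⟩
  rw [le_div_iff₀ hc, mul_comm]
  refine (hhom w).trans (add_le_add ?_ ?_)
  · rw [← nsmul_eq_mul]
    exact Finset.sum_le_card_nsmul _ _ _ fun i hi => (hwI i hi).trans (le_abs_self B)
  · rw [← nsmul_eq_mul]
    exact Finset.sum_le_card_nsmul _ _ _ fun j hj =>
      max_le ((hwJ j hj).trans (le_abs_self B)) (abs_nonneg B)

/-- If every point of a segment is within distance `D` of one of `g` points, the segment has
length at most `2 * D * g`. -/
lemma dist_le_of_segment_covered {g : ℕ} {p q : E} {D : ℝ} (x : Fin g → E)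
    (h : ∀ y ∈ segment ℝ p q, ∃ l, dist (x l) y ≤ D) : dist p q ≤ 2 * D * g := by
  have hg : 0 < g := by
    obtain ⟨l, -⟩ := h p (left_mem_segment ℝ p q)
    exact l.pos
  have hg' : (0 : ℝ) < g := by exact_mod_cast hg
  let y : Fin (g + 1) → E := fun n => AffineMap.lineMap p q ((n : ℝ) / g)
  have hy : ∀ n, y n ∈ segment ℝ p q := fun n => by
    rw [segment_eq_image_lineMap]
    refine ⟨_, ⟨by positivity, ?_⟩, rfl⟩
    rw [div_le_one hg']
    exact_mod_cast Nat.lt_succ_iff.1 n.2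
  choose l hl using fun n => h (y n) (hy n)
  obtain ⟨m, n, hmn, hlmn⟩ := Fintype.exists_ne_map_eq_of_card_lt l (by simp)
  have h1 : dist (y m) (y n) ≤ 2 * D := by
    have h2 := hl m
    have h3 := hl n
    rw [← hlmn] at h3
    linarith [dist_triangle_left (y m) (y n) (x (l m))]
  have h4 : (1 : ℝ) ≤ |(m : ℝ) - n| := by
    have : (1 : ℤ) ≤ |(m : ℤ) - n| := Int.one_le_abs (by
      rw [sub_ne_zero]
      exact_mod_cast fun h => hmn (Fin.ext h))
    exact_mod_cast this
  rw [dist_lineMap_lineMap, Real.dist_eq, ← sub_div, abs_div, abs_of_pos hg', div_mul_eq_mul_div,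
    div_le_iff₀ hg'] at h1
  nlinarith [dist_nonneg (x := p) (y := q)]

end Polyhedron

section Forms

variable {r s : ℕ}

/-- The real linear form with integral coefficient vector `f`. -/
def realForm (f : Fin r → ℤ) : EuclideanSpace ℝ (Fin r) →L[ℝ] ℝ :=
  ∑ k, (f k : ℝ) • EuclideanSpace.proj k

lemma realForm_apply (f : Fin r → ℤ) (x : EuclideanSpace ℝ (Fin r)) :
    realForm f x = ∑ k, (f k : ℝ) * x k := by
  simp [realForm]

/-- A lattice point viewed in Euclidean space. -/
def latticePoint (x : Fin r → ℤ) : EuclideanSpace ℝ (Fin r) :=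
  WithLp.toLp 2 fun k => (x k : ℝ)

lemma realForm_latticePoint (f x : Fin r → ℤ) : realForm f (latticePoint x) = lin f x := by
  simp [realForm_apply, latticePoint, lin]

lemma lin_nsmul (f x : Fin r → ℤ) (n : ℕ) : lin f (n • x) = n * lin f x := by
  simp [lin, Finset.mul_sum, mul_left_comm]

lemma lin_sub (f x y : Fin r → ℤ) : lin f (x - y) = lin f x - lin f y := by
  simp [lin, mul_sub]

/-- A full-dimensional semigroup has an element in the interior of its cone. -/
lemma exists_forall_lin_pos (S : AddSubmonoid (Fin r → ℤ)) (σ : Fin s → Fin r → ℤ)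
    (hSgp : ∀ x : Fin r → ℤ, ∃ a ∈ S, ∃ b ∈ S, x = a - b)
    (hrep : ∀ x : Fin r → ℤ, x ∈ S ↔ ∀ i, 0 ≤ lin (σ i) x)
    (hne : ∀ j, ∃ x : Fin r → ℤ, lin (σ j) x < 0) :
    ∃ c : Fin r → ℤ, ∀ i, 1 ≤ lin (σ i) c := by
  have h : ∀ j, ∃ b ∈ S, 1 ≤ lin (σ j) b := by
    intro j
    obtain ⟨x, hx⟩ := hne j
    obtain ⟨a, ha, b, hb, rfl⟩ := hSgp x
    refine ⟨b, hb, ?_⟩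
    have := (hrep a).1 ha j
    rw [lin_sub] at hx
    omega
  choose b hb hb1 using h
  refine ⟨∑ j, b j, fun i => ?_⟩
  rw [← Finset.add_sum_erase _ _ (Finset.mem_univ i), lin_add]
  have := (hrep _).1 (sum_mem (t := Finset.univ.erase i) fun j _ => hb j) i
  have := hb1 i
  omega

/-- Every real point `y` has, uniformly nearby, a lattice point in `y + C(S)`. -/
lemma exists_lattice_near (σ : Fin s → Fin r → ℤ) (c : Fin r → ℤ) (hc : ∀ i, 1 ≤ lin (σ i) c) :
    ∃ B : ℝ, ∀ y : EuclideanSpace ℝ (Fin r), ∃ z : Fin r → ℤ,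
      ∀ i, realForm (σ i) y ≤ lin (σ i) z ∧ (lin (σ i) z : ℝ) ≤ realForm (σ i) y + B := by
  let N : ℕ := ∑ i, ∑ k, (σ i k).natAbs
  let C : ℝ := ∑ i, (lin (σ i) c : ℝ)
  refine ⟨N + N * C, fun y => ⟨(fun k => ⌊y k⌋) + N • c, fun i => ?_⟩⟩
  have hfl : |realForm (σ i) y - lin (σ i) (fun k => ⌊y k⌋)| ≤ (N : ℝ) := by
    have h1 : realForm (σ i) y - lin (σ i) (fun k => ⌊y k⌋) =
        ∑ k, (σ i k : ℝ) * Int.fract (y k) := by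
      simp only [realForm_apply, lin, Int.cast_sum, Int.cast_mul, ← Finset.sum_sub_distrib,
        ← mul_sub, Int.fract]
    rw [h1]
    calc |∑ k, (σ i k : ℝ) * Int.fract (y k)| ≤ ∑ k, |(σ i k : ℝ) * Int.fract (y k)| :=
          Finset.abs_sum_le_sum_abs _ _
      _ ≤ ∑ k, ((σ i k).natAbs : ℝ) := Finset.sum_le_sum fun k _ => by
          rw [abs_mul, abs_of_nonneg (Int.fract_nonneg (y k)), Nat.cast_natAbs, Int.cast_abs]
          exact mul_le_of_le_one_right (abs_nonneg _) (Int.fract_lt_one _).le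
      _ ≤ N := by
          have := Finset.single_le_sum (f := fun i => ∑ k, (σ i k).natAbs) (fun _ _ => Nat.zero_le _)
            (Finset.mem_univ i)
          exact_mod_cast this
  have hc1 : ∀ i, (1 : ℝ) ≤ lin (σ i) c := fun i => by exact_mod_cast hc i
  have hC : (lin (σ i) c : ℝ) ≤ C :=
    Finset.single_le_sum (f := fun i => (lin (σ i) c : ℝ)) (fun j _ => by linarith [hc1 j])
      (Finset.mem_univ i)
  rw [lin_add, lin_nsmul]
  push_cast
  have hN : (0 : ℝ) ≤ N := Nat.cast_nonneg N
  have := mul_le_mul_of_nonneg_left (hc1 i) hN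
  have := mul_le_mul_of_nonneg_left hC hN
  obtain ⟨h1, h2⟩ := abs_le.1 hfl
  constructor <;> linarith

end Forms

/-- Lemma: compact one-dimensional faces bound `μ` from below.
There is a constant `M > 0`, depending only on `S`, such that whenever `T(a) ≠ ∅` and the
segment `[p,q]` is a face (an extreme subset) of the polyhedron
`C(a) = {x ∈ ℝ^r : σ_i(x) ≥ a_i}`, every covering of `T(a)` by `g` translates `x_i + S`
with `x_i ∈ T(a)` satisfies `g ≥ M·‖p−q‖`; that is, `μ(D(a)) ≥ M·‖p−q‖`. -/
theorem mu_ge_const_mul_face_length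
    {r s : ℕ}
    (S : AddSubmonoid (Fin r → ℤ)) (σ : Fin s → Fin r → ℤ)
    (hSfg : S.FG)
    (hSpos : ∀ x ∈ S, -x ∈ S → x = 0)
    (hSgp : ∀ x : Fin r → ℤ, ∃ a ∈ S, ∃ b ∈ S, x = a - b)
    (hrep : ∀ x : Fin r → ℤ, x ∈ S ↔ ∀ i, 0 ≤ lin (σ i) x)
    (hirr : ∀ j, ∃ x : Fin r → ℤ, lin (σ j) x < 0 ∧ ∀ i, i ≠ j → 0 ≤ lin (σ i) x)
    (hprim : ∀ i, Finset.univ.gcd (σ i) = 1) :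
    ∃ M : ℝ, 0 < M ∧
      ∀ a : Fin s → ℤ, (Tset σ a).Nonempty →
        ∀ p q : EuclideanSpace ℝ (Fin r),
          IsExtreme ℝ
            {x : EuclideanSpace ℝ (Fin r) | ∀ i, (a i : ℝ) ≤ ∑ k, (σ i k : ℝ) * x k}
            (segment ℝ p q) →
          ∀ (g : ℕ) (x : Fin g → Fin r → ℤ), (∀ i, x i ∈ Tset σ a) →
            Tset σ a = (⋃ i, (fun y => x i + y) '' (S : Set (Fin r → ℤ))) →
            M * dist p q ≤ (g : ℝ) := by
  classical
  obtain ⟨c, hc⟩ := exists_forall_lin_pos S σ hSgp hrep fun j => (hirr j).imp fun _ h => h.1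
  obtain ⟨B, hB⟩ := exists_lattice_near σ c hc
  let L : Fin s → EuclideanSpace ℝ (Fin r) →L[ℝ] ℝ := fun i => realForm (σ i)
  have hbound : ∀ IJ : Finset (Fin s) × Finset (Fin s), ∃ D : ℝ,
      (∀ w, (∀ i ∈ IJ.1, L i w = 0) → (∀ j ∈ IJ.2, L j w ≤ 0) → w = 0) →
      ∀ w, (∀ i ∈ IJ.1, |L i w| ≤ B) → (∀ j ∈ IJ.2, L j w ≤ B) → ‖w‖ ≤ D := by
    intro IJ
    by_cases h : ∀ w, (∀ i ∈ IJ.1, L i w = 0) → (∀ j ∈ IJ.2, L j w ≤ 0) → w = 0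
    · obtain ⟨D, hD⟩ := exists_norm_le_of_recession_trivial L IJ.1 IJ.2 B h
      exact ⟨D, fun _ => hD⟩
    · exact ⟨0, fun h' => absurd h' h⟩
  choose D hD using hbound
  obtain ⟨D₀, hD₀⟩ := (Set.finite_range D).bddAbove
  have hM : 0 < 2 * |D₀| + 1 := by positivity
  refine ⟨(2 * |D₀| + 1)⁻¹, inv_pos.2 hM, fun a _ p q hE g x hx hcov => ?_⟩
  rw [inv_mul_le_iff₀ hM]
  rcases eq_or_ne p q with rfl | hpq
  · rw [dist_self]
    positivity
  have hE' : IsExtreme ℝ {x | ∀ i, (a i : ℝ) ≤ L i x} (segment ℝ p q) := by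
    simpa only [L, realForm_apply] using hE
  let I : Finset (Fin s) := {i | L i p = a i ∧ L i q = a i}
  let J : Finset (Fin s) := {i | L i p = a i ∨ L i q = a i}
  have hgood : ∀ w, (∀ i ∈ I, L i w = 0) → (∀ j ∈ J, L j w ≤ 0) → w = 0 := fun w hI hJ =>
    eq_zero_of_isExtreme_segment hpq hE' (fun i hi => hI i (by simpa [I] using hi))
      fun i hi => hJ i (by simpa [J] using hi)
  have hnear : ∀ y ∈ segment ℝ p q, ∃ l, dist (latticePoint (x l)) y ≤ |D₀| := by
    intro y hy
    have hyC := hE'.1 hy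
    obtain ⟨z, hz⟩ := hB y
    have hzT : z ∈ Tset σ a := fun i => by
      exact_mod_cast (hyC i).trans (hz i).1
    rw [hcov] at hzT
    obtain ⟨l, u, hu, rfl⟩ := Set.mem_iUnion.1 hzT
    have hup : ∀ i, L i (latticePoint (x l) - y) ≤ B := by
      intro i
      have h1 : (0 : ℝ) ≤ lin (σ i) u := by exact_mod_cast (hrep u).1 hu i
      have h2 := (hz i).2
      simp only [lin_add, Int.cast_add] at h2
      simp only [L, map_sub, realForm_latticePoint]
      linarith
    refine ⟨l, ?_⟩
    rw [dist_eq_norm]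
    refine ((hD (I, J) hgood _ (fun i hi => ?_) fun j _ => hup j).trans
      (hD₀ ⟨_, rfl⟩)).trans (le_abs_self D₀)
    have hyi : L i y = a i := by
      obtain ⟨hp, hq⟩ : L i p = a i ∧ L i q = a i := by simpa [I] using hi
      obtain ⟨α, β, -, -, hαβ, rfl⟩ := hy
      rw [map_add, map_smul, map_smul, hp, hq, ← add_smul, hαβ, one_smul]
    have hlow : (0 : ℝ) ≤ L i (latticePoint (x l) - y) := by
      have : (a i : ℝ) ≤ lin (σ i) (x l) := by exact_mod_cast hx l i
      rw [map_sub, hyi]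
      simp only [L, realForm_latticePoint]
      linarith
    rw [abs_of_nonneg hlow]
    exact hup i
  have := dist_le_of_segment_covered (fun l => latticePoint (x l)) hnear
  have : (0 : ℝ) ≤ g := Nat.cast_nonneg g
  linarith
end
end

section
/- Let ξ_1,…,ξ_n : ℤ^r → ℤ be nonzero linear forms such that S = {x ∈ ℤ^r : ξ_i(x) ≥ 0 for all i} is positive (0 is its only invertible element) and gp(S) = ℤ^r; let K be a field and R = K[S]. For a, b ∈ ℤ^n the ξ-convex ideals I(a;ξ) = K·T(a;ξ) and I(b;ξ) = K·T(b;ξ) are isomorphic as R-modules if and only if there exists y ∈ ℤ^r with T(b;ξ) = y + T(a;ξ). -/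
set_option synthInstance.maxHeartbeats 1000000
set_option maxHeartbeats 1000000

open scoped BigOperators

noncomputable section

/-- The monomial of exponent `x` in the group algebra `K[ℤ^r]`. -/
def mono (K : Type*) [Field K] {r : ℕ} (x : Fin r → ℤ) : AddMonoidAlgebra K (Fin r → ℤ) :=
  AddMonoidAlgebra.single x 1

/-- The affine semigroup ring `K[S]`, as a subalgebra of `K[ℤ^r]`. -/
def semigroupRing (K : Type*) [Field K] {r : ℕ} (S : AddSubmonoid (Fin r → ℤ)) :
    Subalgebra K (AddMonoidAlgebra K (Fin r → ℤ)) :=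
  Algebra.adjoin K {f | ∃ x ∈ S, f = mono K x}

/-- The monomial (fractional) ideal of `K[S]` with monomial basis `T ⊆ ℤ^r`, as a
`K[S]`-submodule of `K[ℤ^r]`.  (When `S + T ⊆ T`, its underlying set is the `K`-span
of the monomials with exponents in `T`.) -/
def monIdeal (K : Type*) [Field K] {r : ℕ} (S : AddSubmonoid (Fin r → ℤ))
    (T : Set (Fin r → ℤ)) :
    Submodule ↥(semigroupRing K S) (AddMonoidAlgebra K (Fin r → ℤ)) :=
  Submodule.span _ {f | ∃ x ∈ T, f = mono K x}

/-- The maximal ideal of `K[S]` generated by all nonunit monomials. -/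
def irrelevantIdeal (K : Type*) [Field K] {r : ℕ} (S : AddSubmonoid (Fin r → ℤ)) :
    Ideal ↥(semigroupRing K S) :=
  Ideal.span {f | ∃ x ∈ S, x ≠ 0 ∧ (f : AddMonoidAlgebra K (Fin r → ℤ)) = mono K x}

/-- `M` is a Cohen–Macaulay module with respect to the ideal `I ⊆ R`: the length of a
maximal `M`-regular sequence contained in `I` equals the Krull dimension of `M`
(the Krull dimension of `R/ann(M)`). -/
def IsCohenMacaulayMod (R : Type*) [CommRing R] (I : Ideal R)
    (M : Type*) [AddCommGroup M] [Module R M] : Prop :=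
  ∃ rs : List R, (∀ x ∈ rs, x ∈ I) ∧ RingTheory.Sequence.IsRegular M rs ∧
    (∀ y ∈ I, ¬ RingTheory.Sequence.IsRegular M (rs ++ [y])) ∧
    (rs.length : WithBot ℕ∞) = ringKrullDim (R ⧸ Module.annihilator R M)

/-- The normal semigroup of solutions of the homogeneous system `ξ_i(x) ≥ 0`. -/
def ineqSemigroup {r n : ℕ} (ξ : Fin n → Fin r → ℤ) : AddSubmonoid (Fin r → ℤ) where
  carrier := {x | ∀ i, 0 ≤ lin (ξ i) x}
  zero_mem' := fun i => by simp [lin_zero]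
  add_mem' := fun hx hy i => by rw [lin_add]; exact add_nonneg (hx i) (hy i)

section MonomialIdeals

variable {K : Type*} [Field K] {r : ℕ}

lemma mono_add (x y : Fin r → ℤ) : mono K (x + y) = mono K x * mono K y := by
  simp [mono, AddMonoidAlgebra.single_mul_single]

lemma mono_zero : mono K (0 : Fin r → ℤ) = 1 := rfl

lemma mono_mul_mono_neg (x : Fin r → ℤ) : mono K x * mono K (-x) = 1 := by
  rw [← mono_add, add_neg_cancel, mono_zero]

lemma mono_ne_zero (x : Fin r → ℤ) : mono K x ≠ 0 :=
  left_ne_zero_of_mul_eq_one (mono_mul_mono_neg x)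

/-- The unit of `K[ℤ^r]` given by a monomial. -/
def monoUnit (K : Type*) [Field K] {r : ℕ} (x : Fin r → ℤ) :
    (AddMonoidAlgebra K (Fin r → ℤ))ˣ where
  val := mono K x
  inv := mono K (-x)
  val_inv := mono_mul_mono_neg x
  inv_val := by rw [mul_comm, mono_mul_mono_neg]

lemma exists_add_eq_of_coeff_mul_ne_zero {f g : AddMonoidAlgebra K (Fin r → ℤ)}
    {z : Fin r → ℤ} (hz : (f * g).coeff z ≠ 0) :
    ∃ x y, f.coeff x ≠ 0 ∧ g.coeff y ≠ 0 ∧ x + y = z := by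
  classical
  obtain ⟨x, hx, y, hy, hxy⟩ := Finset.mem_add.1
    (AddMonoidAlgebra.support_coeff_mul_subset f g (Finsupp.mem_support_iff.2 hz))
  exact ⟨x, y, Finsupp.mem_support_iff.1 hx, Finsupp.mem_support_iff.1 hy, hxy⟩

lemma eq_of_coeff_mono_ne_zero {x z : Fin r → ℤ} (h : (mono K x).coeff z ≠ 0) : z = x := by
  by_contra hne
  exact h (by simp [mono, Ne.symm hne])

lemma coeff_mul_mono_add (f : AddMonoidAlgebra K (Fin r → ℤ)) (y t : Fin r → ℤ) :
    (f * mono K t).coeff (y + t) = f.coeff y := by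
  simp [mono]

variable {S : AddSubmonoid (Fin r → ℤ)} {T : Set (Fin r → ℤ)}

lemma mono_mem_semigroupRing {x : Fin r → ℤ} (hx : x ∈ S) : mono K x ∈ semigroupRing K S :=
  Algebra.subset_adjoin ⟨x, hx, rfl⟩

lemma mono_mem_monIdeal {x : Fin r → ℤ} (hx : x ∈ T) : mono K x ∈ monIdeal K S T :=
  Submodule.subset_span ⟨x, hx, rfl⟩

lemma mem_of_mem_semigroupRing {f : AddMonoidAlgebra K (Fin r → ℤ)}
    (hf : f ∈ semigroupRing K S) {z : Fin r → ℤ} (hz : f.coeff z ≠ 0) : z ∈ S := by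
  induction hf using Algebra.adjoin_induction generalizing z with
  | mem f hf =>
    obtain ⟨x, hx, rfl⟩ := hf
    rwa [eq_of_coeff_mono_ne_zero hz]
  | algebraMap c =>
    by_contra hne
    have h0 : z ≠ 0 := fun h => hne (h ▸ S.zero_mem)
    exact hz (by simp [h0.symm])
  | add f g _ _ hf hg =>
    by_contra hne
    have h1 : f.coeff z = 0 := not_not.1 fun h => hne (hf h)
    have h2 : g.coeff z = 0 := not_not.1 fun h => hne (hg h)
    exact hz (by simp [h1, h2])
  | mul f g _ _ hf hg =>
    obtain ⟨x, y, hx, hy, rfl⟩ := exists_add_eq_of_coeff_mul_ne_zero hz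
    exact S.add_mem (hf hx) (hg hy)

lemma mem_of_mem_monIdeal (hT : ∀ s ∈ S, ∀ t ∈ T, s + t ∈ T)
    {f : AddMonoidAlgebra K (Fin r → ℤ)} (hf : f ∈ monIdeal K S T) {z : Fin r → ℤ}
    (hz : f.coeff z ≠ 0) : z ∈ T := by
  induction hf using Submodule.span_induction generalizing z with
  | mem f hf =>
    obtain ⟨x, hx, rfl⟩ := hf
    rwa [eq_of_coeff_mono_ne_zero hz]
  | zero => exact absurd rfl hz
  | add f g _ _ hf hg =>
    by_contra hne
    have h1 : f.coeff z = 0 := not_not.1 fun h => hne (hf h)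
    have h2 : g.coeff z = 0 := not_not.1 fun h => hne (hg h)
    exact hz (by simp [h1, h2])
  | smul c f _ hf =>
    obtain ⟨x, y, hx, hy, rfl⟩ := exists_add_eq_of_coeff_mul_ne_zero
      (f := (c : AddMonoidAlgebra K (Fin r → ℤ))) hz
    exact hT x (mem_of_mem_semigroupRing c.2 hx) y (hf hy)

/-- If `S` generates `ℤ^r`, a `K[S]`-linear map from a nonzero monomial ideal to `K[ℤ^r]` is
multiplication by an element of `K[ℤ^r]`. -/
lemma exists_eq_mul_of_linearMap_monIdeal (hgp : ∀ x : Fin r → ℤ, ∃ a ∈ S, ∃ b ∈ S, x = a - b)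
    (hT : T.Nonempty)
    (φ : ↥(monIdeal K S T) →ₗ[↥(semigroupRing K S)] AddMonoidAlgebra K (Fin r → ℤ)) :
    ∃ f : AddMonoidAlgebra K (Fin r → ℤ), ∀ m : ↥(monIdeal K S T), φ m = f * m := by
  obtain ⟨t, ht⟩ := hT
  refine ⟨φ ⟨mono K t, mono_mem_monIdeal ht⟩ * mono K (-t), fun ⟨m, hm⟩ => ?_⟩
  induction hm using Submodule.span_induction with
  | mem m hm =>
    obtain ⟨u, hu, rfl⟩ := hm
    obtain ⟨p, hp, q, hq, hpq⟩ := hgp (u - t)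
    have hqu : u + q = p + t := sub_eq_sub_iff_add_eq_add.1 hpq
    have key : (⟨mono K q, mono_mem_semigroupRing hq⟩ : ↥(semigroupRing K S)) •
          (⟨mono K u, mono_mem_monIdeal hu⟩ : ↥(monIdeal K S T)) =
        (⟨mono K p, mono_mem_semigroupRing hp⟩ : ↥(semigroupRing K S)) •
          (⟨mono K t, mono_mem_monIdeal ht⟩ : ↥(monIdeal K S T)) := by
      apply Subtype.ext
      change mono K q * mono K u = mono K p * mono K t
      rw [← mono_add, ← mono_add, add_comm q u, hqu]
    have h := congrArg φ key
    rw [map_smul, map_smul] at h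
    change mono K q * _ = mono K p * _ at h
    have hu' : mono K u = mono K (-q) * mono K p * mono K t := by
      rw [← mono_add, ← mono_add, add_assoc, ← hqu, add_comm u q, neg_add_cancel_left]
    calc _ = (mono K q * mono K (-q)) * φ ⟨mono K u, mono_mem_monIdeal hu⟩ := by
          rw [mono_mul_mono_neg, one_mul]
      _ = mono K (-q) * (mono K q * φ ⟨mono K u, mono_mem_monIdeal hu⟩) := by ring
      _ = (mono K t * mono K (-t)) *
          (mono K (-q) * (mono K p * φ ⟨mono K t, mono_mem_monIdeal ht⟩)) := by
          rw [h, mono_mul_mono_neg, one_mul]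
      _ = _ := by
          change _ = _ * mono K u
          rw [hu']; ring
  | zero => exact (map_zero φ).trans (mul_zero _).symm
  | add m m' hm hm' h h' =>
    refine (map_add φ ⟨m, hm⟩ ⟨m', hm'⟩).trans ?_
    rw [h, h']
    exact (mul_add _ _ _).symm
  | smul c m hm h =>
    refine (map_smul φ c ⟨m, hm⟩).trans ?_
    rw [h]
    exact mul_left_comm (c : AddMonoidAlgebra K (Fin r → ℤ)) _ _

lemma map_mulLeftLinearEquiv_monIdeal (y : Fin r → ℤ) :
    (monIdeal K S T).map (Units.mulLeftLinearEquiv (semigroupRing K S)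
      (AddMonoidAlgebra K (Fin r → ℤ)) (monoUnit K y)).toLinearMap =
      monIdeal K S ((fun x => y + x) '' T) := by
  rw [monIdeal, monIdeal, Submodule.map_span]
  congr 1
  ext f
  constructor
  · rintro ⟨_, ⟨x, hx, rfl⟩, rfl⟩
    exact ⟨y + x, ⟨x, hx, rfl⟩, (mono_add y x).symm⟩
  · rintro ⟨_, ⟨x, hx, rfl⟩, rfl⟩
    exact ⟨mono K x, ⟨x, hx, rfl⟩, (mono_add y x).symm⟩

lemma nonempty_of_monIdeal_linearEquiv {T' : Set (Fin r → ℤ)}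
    (e : ↥(monIdeal K S T) ≃ₗ[↥(semigroupRing K S)] ↥(monIdeal K S T')) (hT : T.Nonempty) :
    T'.Nonempty := by
  obtain ⟨t, ht⟩ := hT
  by_contra hne
  rw [Set.not_nonempty_iff_eq_empty] at hne
  subst hne
  have hbot : monIdeal K S ∅ = ⊥ := by simp [monIdeal]
  have h0 : e ⟨mono K t, mono_mem_monIdeal ht⟩ = 0 :=
    Subtype.ext ((Submodule.mem_bot _).1 (hbot.le (e _).2))
  exact mono_ne_zero t (congrArg Subtype.val (e.map_eq_zero_iff.1 h0))

/-- Monomial ideals of `K[S]` are isomorphic if and only if their exponent sets are translates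
of each other. -/
lemma nonempty_monIdeal_linearEquiv_iff {T' : Set (Fin r → ℤ)}
    (hgp : ∀ x : Fin r → ℤ, ∃ a ∈ S, ∃ b ∈ S, x = a - b)
    (hT : ∀ s ∈ S, ∀ t ∈ T, s + t ∈ T) (hT' : ∀ s ∈ S, ∀ t ∈ T', s + t ∈ T') :
    Nonempty (↥(monIdeal K S T) ≃ₗ[↥(semigroupRing K S)] ↥(monIdeal K S T')) ↔
      ∃ y : Fin r → ℤ, T' = (fun x => y + x) '' T := by
  constructor
  · rintro ⟨e⟩
    rcases T.eq_empty_or_nonempty with rfl | hne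
    · refine ⟨0, ?_⟩
      rw [Set.image_empty, ← Set.not_nonempty_iff_eq_empty]
      exact fun h => Set.not_nonempty_empty (nonempty_of_monIdeal_linearEquiv e.symm h)
    have hne' := nonempty_of_monIdeal_linearEquiv e hne
    obtain ⟨f, hf⟩ := exists_eq_mul_of_linearMap_monIdeal hgp hne
      ((monIdeal K S T').subtype ∘ₗ e.toLinearMap)
    obtain ⟨g, hg⟩ := exists_eq_mul_of_linearMap_monIdeal hgp hne'
      ((monIdeal K S T).subtype ∘ₗ e.symm.toLinearMap)
    change ∀ m, ((e m : _) : AddMonoidAlgebra K (Fin r → ℤ)) = _ at hf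
    change ∀ m, ((e.symm m : _) : AddMonoidAlgebra K (Fin r → ℤ)) = _ at hg
    have hfg : f * g = 1 := by
      obtain ⟨t, ht⟩ := hne'
      have h := hf (e.symm ⟨mono K t, mono_mem_monIdeal ht⟩)
      rw [e.apply_symm_apply, hg, ← mul_assoc] at h
      change mono K t = _ * mono K t at h
      rw [← mul_one (f * g), ← mono_mul_mono_neg (K := K) t, ← mul_assoc, ← h]
    obtain ⟨y, z, hy, hz, hyz⟩ : ∃ y z, f.coeff y ≠ 0 ∧ g.coeff z ≠ 0 ∧ y + z = 0 := by
      apply exists_add_eq_of_coeff_mul_ne_zero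
      rw [hfg, AddMonoidAlgebra.coeff_one_zero]
      exact one_ne_zero
    refine ⟨y, Set.Subset.antisymm (fun t ht => ⟨z + t, ?_, ?_⟩) ?_⟩
    · refine mem_of_mem_monIdeal hT (e.symm ⟨mono K t, mono_mem_monIdeal ht⟩).2 ?_
      rwa [hg, coeff_mul_mono_add]
    · change y + (z + t) = t
      rw [← add_assoc, hyz, zero_add]
    · rintro _ ⟨t, ht, rfl⟩
      refine mem_of_mem_monIdeal hT' (e ⟨mono K t, mono_mem_monIdeal ht⟩).2 ?_
      rwa [hf, coeff_mul_mono_add]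
  · rintro ⟨y, rfl⟩
    exact ⟨((Units.mulLeftLinearEquiv (semigroupRing K S) (AddMonoidAlgebra K (Fin r → ℤ))
      (monoUnit K y)).submoduleMap (monIdeal K S T)).trans
        (LinearEquiv.ofEq _ _ (map_mulLeftLinearEquiv_monIdeal y))⟩

end MonomialIdeals

lemma add_mem_Tset {r n : ℕ} (ξ : Fin n → Fin r → ℤ) (a : Fin n → ℤ) :
    ∀ s ∈ ineqSemigroup ξ, ∀ t ∈ Tset ξ a, s + t ∈ Tset ξ a := fun s hs t ht i => by
  rw [lin_add]
  exact (ht i).trans (le_add_of_nonneg_left (hs i))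

/-- Proposition: isomorphism of `ξ`-convex ideals.
Let `S = {x ∈ ℤ^r : ξ_i(x) ≥ 0}` be positive with `gp(S) = ℤ^r`, and `R = K[S]`.
Two `ξ`-convex ideals `I(a;ξ) = K·T(a;ξ)` and `I(b;ξ) = K·T(b;ξ)` are isomorphic as
`R`-modules if and only if `T(b;ξ)` is a translate `y + T(a;ξ)` for some `y ∈ ℤ^r`. -/
theorem xi_convex_ideals_iso_iff_translate
    {r n : ℕ} (K : Type*) [Field K]
    (ξ : Fin n → Fin r → ℤ)
    (hξ : ∀ i, ξ i ≠ 0)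
    (hpos : ∀ x ∈ ineqSemigroup ξ, -x ∈ ineqSemigroup ξ → x = 0)
    (hgp : ∀ x : Fin r → ℤ, ∃ a ∈ ineqSemigroup ξ, ∃ b ∈ ineqSemigroup ξ, x = a - b)
    (a b : Fin n → ℤ) :
    Nonempty (↥(monIdeal K (ineqSemigroup ξ) (Tset ξ a)) ≃ₗ[↥(semigroupRing K (ineqSemigroup ξ))]
        ↥(monIdeal K (ineqSemigroup ξ) (Tset ξ b))) ↔
      ∃ y : Fin r → ℤ, Tset ξ b = (fun x => y + x) '' Tset ξ a := by
  exact nonempty_monIdeal_linearEquiv_iff hgp (add_mem_Tset ξ a) (add_mem_Tset ξ b)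
end
end

section
/- Let G be a finitely generated abelian group, S a finitely generated subsemigroup (submonoid) of G, and T ⊆ G a finitely generated S-module, i.e. S + T ⊆ T and T = ⋃_{i=1}^k (S + t_i) for finitely many t_1,…,t_k ∈ G. Let R be a Noetherian commutative ring graded by G and M a finitely generated G-graded R-module. Then: (a) R_0 is a Noetherian ring and each graded component M_g, g ∈ G, is a finitely generated R_0-module; (b) A = ⊕_{s∈S} R_s is a finitely generated R_0-algebra; (c) N = ⊕_{t∈T} M_t is a finitely generated A-module. -/
set_option synthInstance.maxHeartbeats 1000000
set_option maxHeartbeats 1000000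

open scoped BigOperators DirectSum

noncomputable section

/-- The degree-zero part `R_0` of a `G`-graded ring, as a subring. -/
def zeroSubring {G R : Type*} [AddCommGroup G] [CommRing R]
    (𝒜 : G → AddSubgroup R) (h1 : (1 : R) ∈ 𝒜 0)
    (hmul : ∀ (g h : G) (a b : R), a ∈ 𝒜 g → b ∈ 𝒜 h → a * b ∈ 𝒜 (g + h)) :
    Subring R where
  carrier := 𝒜 0
  zero_mem' := (𝒜 0).zero_mem
  one_mem' := h1
  add_mem' {a b} ha hb := (𝒜 0).add_mem ha hb
  neg_mem' {a} ha := (𝒜 0).neg_mem ha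
  mul_mem' {a b} ha hb := by simpa using hmul 0 0 a b ha hb

/-- Families of additive projections `p` and `q` onto the pieces of a graded ring `𝒜` and of a
graded module `ℳ`, compatible with multiplication by homogeneous elements. -/
structure IsGradedProj {G R M : Type*} [AddCommGroup G] [CommRing R] [AddCommGroup M] [Module R M]
    (𝒜 : G → AddSubgroup R) (p : G → R →+ R) (ℳ : G → AddSubgroup M) (q : G → M →+ M) :
    Prop where
  mem : ∀ g x, q g x ∈ ℳ g
  eq_self : ∀ g, ∀ x ∈ ℳ g, q g x = x
  smul_right : ∀ g h a, ∀ x ∈ ℳ h, q (g + h) (a • x) = p g a • x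
  smul_left : ∀ g h, ∀ a ∈ 𝒜 h, ∀ x, q (h + g) (a • x) = a • q g x

/-- The projections onto the pieces of an internal direct sum. -/
theorem exists_projections {G M : Type*} [DecidableEq G] [AddCommGroup M]
    (ℳ : G → AddSubgroup M) (hM : DirectSum.IsInternal fun g : G => ℳ g) :
    ∃ q : G → M →+ M, (∀ g x, q g x ∈ ℳ g) ∧ (∀ g, ∀ x ∈ ℳ g, q g x = x) ∧
      ∀ g h, g ≠ h → ∀ x ∈ ℳ g, q h x = 0 := by
  let e := AddEquiv.ofBijective (DirectSum.coeAddMonoidHom ℳ) hM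
  have he (g : G) (x : M) (hx : x ∈ ℳ g) :
      e.symm x = DirectSum.of (fun g => ℳ g) g ⟨x, hx⟩ := by
    rw [AddEquiv.symm_apply_eq]
    exact (DirectSum.coeAddMonoidHom_of ℳ g ⟨x, hx⟩).symm
  refine ⟨fun g => (ℳ g).subtype.comp
    ((DFinsupp.evalAddMonoidHom g).comp e.symm.toAddMonoidHom), fun g x => ?_,
    fun g x hx => ?_, fun g h hgh x hx => ?_⟩
  · exact SetLike.coe_mem _
  · change ((e.symm x) g : M) = x
    rw [he g x hx, DirectSum.of_eq_same]
  · change ((e.symm x) h : M) = 0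
    rw [he g x hx, DirectSum.of_eq_of_ne _ _ _ hgh.symm]
    rfl

theorem addSubgroup_internal_induction {G M : Type*} [DecidableEq G] [AddCommGroup M]
    {ℳ : G → AddSubgroup M} (hM : DirectSum.IsInternal fun g : G => ℳ g) {P : M → Prop}
    (zero : P 0) (piece : ∀ g, ∀ x ∈ ℳ g, P x) (map_add : ∀ x y, P x → P y → P (x + y)) (x : M) :
    P x := by
  obtain ⟨y, rfl⟩ := hM.2 x
  induction y using DirectSum.induction_on with
  | zero => simpa using zero
  | of g x => simpa using piece g x x.2
  | add x y hx hy => simpa using map_add _ _ hx hy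

theorem isGradedProj_of_isInternal {G R M : Type*} [AddCommGroup G] [DecidableEq G] [CommRing R]
    [AddCommGroup M] [Module R M] {𝒜 : G → AddSubgroup R} {ℳ : G → AddSubgroup M}
    (hsmul : ∀ (g h : G) (a : R) (x : M), a ∈ 𝒜 g → x ∈ ℳ h → a • x ∈ ℳ (g + h))
    (hA : DirectSum.IsInternal fun g : G => 𝒜 g) (hM : DirectSum.IsInternal fun g : G => ℳ g)
    {p : G → R →+ R} (hp : ∀ g, ∀ x ∈ 𝒜 g, p g x = x)
    (hp0 : ∀ g h, g ≠ h → ∀ x ∈ 𝒜 g, p h x = 0) {q : G → M →+ M} (hq_mem : ∀ g x, q g x ∈ ℳ g)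
    (hq : ∀ g, ∀ x ∈ ℳ g, q g x = x) (hq0 : ∀ g h, g ≠ h → ∀ x ∈ ℳ g, q h x = 0) :
    IsGradedProj 𝒜 p ℳ q where
  mem := hq_mem
  eq_self := hq
  smul_right g h a x hx := by
    induction a using addSubgroup_internal_induction hA with
    | zero => simp
    | piece k a ha =>
      rcases eq_or_ne k g with rfl | hk
      · rw [hq _ _ (hsmul _ _ _ _ ha hx), hp _ _ ha]
      · rw [hq0 (k + h) _ (by simpa using hk) _ (hsmul _ _ _ _ ha hx), hp0 _ _ hk _ ha, zero_smul]
    | map_add a b ha hb => simp [add_smul, ha, hb]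
  smul_left g h a ha x := by
    induction x using addSubgroup_internal_induction hM with
    | zero => simp
    | piece k x hx =>
      rcases eq_or_ne k g with rfl | hk
      · rw [hq _ _ (hsmul _ _ _ _ ha hx), hq _ _ hx]
      · rw [hq0 (h + k) _ (by simpa using hk) _ (hsmul _ _ _ _ ha hx), hq0 _ _ hk _ hx, smul_zero]
    | map_add x y hx hy => simp [smul_add, hx, hy]

/-- Noetherianity descends along an additive retraction `ρ` that maps the `P`-multiples of the
image of each element to its `B`-multiples. -/
theorem isNoetherian_of_retraction {P M B N : Type*} [CommRing P] [AddCommGroup M] [Module P M]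
    [IsNoetherian P M] [CommRing B] [AddCommGroup N] [Module B N] (i : N → M) (ρ : M →+ N)
    (hi : ∀ n, ρ (i n) = n) (hρ : ∀ (p : P) (n : N), ∃ b : B, ρ (p • i n) = b • n) :
    IsNoetherian B N := by
  have key (K : Submodule B N) (x : M) (hx : x ∈ Submodule.span P (i '' K)) : ρ x ∈ K := by
    induction hx using Submodule.closure_induction with
    | zero => simp
    | add x y _ _ hx hy => simpa using K.add_mem hx hy
    | smul_mem p x hx =>
      obtain ⟨n, hn, rfl⟩ := hx
      obtain ⟨b, hb⟩ := hρ p n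
      exact hb ▸ K.smul_mem b hn
  have hmono : StrictMono fun K : Submodule B N => Submodule.span P (i '' (K : Set N)) := by
    refine Monotone.strictMono_of_injective
      (fun K L hKL => Submodule.span_mono (Set.image_mono hKL)) ?_
    have hle (K L : Submodule B N)
        (h : Submodule.span P (i '' (K : Set N)) = Submodule.span P (i '' (L : Set N))) :
        K ≤ L := fun n hn => by
      have hn' := key L (i n) (h ▸ Submodule.subset_span ⟨n, hn, rfl⟩)
      rwa [hi] at hn'
    exact fun K L h => le_antisymm (hle K L h) (hle L K h.symm)
  rw [isNoetherian_iff']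
  exact hmono.wellFoundedGT

theorem span_subring_eq_closure {R M : Type*} [CommRing R] [AddCommGroup M] [Module R M]
    (B : Subring R) (F : Finset M) :
    (Submodule.span B (F : Set M) : Set M) =
      AddSubgroup.closure {y : M | ∃ a ∈ B, ∃ f ∈ F, y = a • f} := by
  refine Set.Subset.antisymm (fun x hx => ?_) ?_
  · induction hx using Submodule.closure_induction with
    | zero => exact zero_mem _
    | add x y _ _ hx hy => exact add_mem hx hy
    | smul_mem b x hx => exact AddSubgroup.subset_closure ⟨b, b.2, x, hx, rfl⟩
  · refine (AddSubgroup.closure_le (Submodule.span B (F : Set M)).toAddSubgroup).2 ?_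
    rintro _ ⟨a, ha, f, hf, rfl⟩
    exact Submodule.smul_mem _ (⟨a, ha⟩ : B) (Submodule.subset_span hf)

/-- A finitely generated commutative monoid is the range of a free one. -/
theorem AddSubmonoid.FG.exists_mrange_eq {G : Type*} [AddCommGroup G] {S : AddSubmonoid G}
    (hS : S.FG) : ∃ (n : Finset G) (d : (n →₀ ℕ) →+ G), AddMonoidHom.mrange d = S := by
  obtain ⟨n, rfl⟩ := hS
  refine ⟨n, Finsupp.liftAddHom fun i => multiplesHom G (i : G), le_antisymm ?_ ?_⟩
  · rintro _ ⟨a, rfl⟩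
    rw [Finsupp.liftAddHom_apply]
    exact _root_.sum_mem fun i _ => nsmul_mem (AddSubmonoid.subset_closure i.2) _
  · exact (AddSubmonoid.closure_le).2 fun g hg => ⟨Finsupp.single ⟨g, hg⟩ 1, by simp⟩

theorem smul_mem_biSup {G R M : Type*} [AddCommGroup G] [CommRing R] [AddCommGroup M] [Module R M]
    {𝒜 : G → AddSubgroup R} {ℳ : G → AddSubgroup M}
    (hsmul : ∀ (g h : G) (a : R) (x : M), a ∈ 𝒜 g → x ∈ ℳ h → a • x ∈ ℳ (g + h))
    {S : AddSubmonoid G} {T : Set G} (hT : ∀ s ∈ S, ∀ t ∈ T, s + t ∈ T) {a : R} {x : M}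
    (ha : a ∈ ⨆ s ∈ S, 𝒜 s) (hx : x ∈ ⨆ t ∈ T, ℳ t) : a • x ∈ ⨆ t ∈ T, ℳ t := by
  have hle : ⨆ s ∈ S, 𝒜 s ≤ (⨆ t ∈ T, ℳ t).comap (smulAddHom R M |>.flip x) := by
    refine iSup₂_le fun s hs b hb => ?_
    have hle' : ⨆ t ∈ T, ℳ t ≤ (⨆ t ∈ T, ℳ t).comap (smulAddHom R M b) :=
      iSup₂_le fun t ht y hy =>
        (le_iSup₂_of_le (s + t) (hT s hs t ht) le_rfl : ℳ (s + t) ≤ ⨆ t ∈ T, ℳ t)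
          (hsmul s t b y hb hy)
    exact hle' hx
  exact hle ha

namespace IsGradedProj

variable {G R M : Type*} [AddCommGroup G] [CommRing R] [AddCommGroup M] [Module R M]
  {𝒜 : G → AddSubgroup R} {p : G → R →+ R} {ℳ : G → AddSubgroup M} {q : G → M →+ M}

theorem smul_mem (hA : IsGradedProj 𝒜 p 𝒜 p) (hM : IsGradedProj 𝒜 p ℳ q) {g h : G} {a : R}
    {x : M} (ha : a ∈ 𝒜 g) (hx : x ∈ ℳ h) : a • x ∈ ℳ (g + h) := by
  have := hM.mem (g + h) (a • x)
  rwa [hM.smul_right g h a x hx, hA.eq_self g a ha] at this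

theorem mul_mem (hA : IsGradedProj 𝒜 p 𝒜 p) {g h : G} {a b : R} (ha : a ∈ 𝒜 g) (hb : b ∈ 𝒜 h) :
    a * b ∈ 𝒜 (g + h) :=
  hA.smul_mem hA ha hb

/-- A graded piece `ℳ g` of a Noetherian graded module is finitely generated over `𝒜 0`. -/
theorem exists_finset_piece [IsNoetherian R M] (hA : IsGradedProj 𝒜 p 𝒜 p)
    (hM : IsGradedProj 𝒜 p ℳ q) (h1 : (1 : R) ∈ 𝒜 0) (g : G) :
    ∃ F : Finset M, (↑F : Set M) ⊆ ℳ g ∧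
      (ℳ g : Set M) =
        ↑(AddSubgroup.closure {y : M | ∃ a ∈ 𝒜 0, ∃ f ∈ F, y = a • f}) := by
  let B := zeroSubring 𝒜 h1 fun _ _ _ _ => hA.mul_mem
  let N : Submodule B M :=
    { ℳ g with
      smul_mem' := fun b x hx => by
        have := hA.smul_mem hM b.2 hx
        rwa [zero_add] at this }
  have : IsNoetherian B N := by
    refine isNoetherian_of_retraction (P := R) (fun n : N => (n : M))
      ((q g).codRestrict N (hM.mem g)) (fun n => Subtype.ext (hM.eq_self g _ n.2))
      fun r n => ⟨⟨p 0 r, hA.mem 0 r⟩, Subtype.ext ?_⟩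
    have := hM.smul_right 0 g r n n.2
    rwa [zero_add] at this
  obtain ⟨F, hF⟩ : N.FG := Module.Finite.iff_fg.1 inferInstance
  refine ⟨F, (Submodule.subset_span.trans hF.le : (F : Set M) ⊆ N), ?_⟩
  exact (congrArg SetLike.coe hF).symm.trans (span_subring_eq_closure B F)

theorem isNoetherianRing_zeroSubring [IsNoetherianRing R] (hA : IsGradedProj 𝒜 p 𝒜 p)
    (h1 : (1 : R) ∈ 𝒜 0)
    (hmul : ∀ (g h : G) (a b : R), a ∈ 𝒜 g → b ∈ 𝒜 h → a * b ∈ 𝒜 (g + h)) :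
    IsNoetherianRing (zeroSubring 𝒜 h1 hmul) := by
  refine isNoetherian_of_retraction (P := R) (fun n : zeroSubring 𝒜 h1 hmul => (n : R))
    ((p 0).codRestrict (zeroSubring 𝒜 h1 hmul) (hA.mem 0))
    (fun n => Subtype.ext (hA.eq_self 0 _ n.2))
    fun r n => ⟨⟨p 0 r, hA.mem 0 r⟩, Subtype.ext ?_⟩
  have := hA.smul_right 0 0 r n n.2
  rwa [zero_add] at this

/-- The polynomials whose coefficient at each exponent `a` is homogeneous of degree `d a`, that is,
the degree-zero part of the polynomial ring when the monomial `a` is given degree `-d a`. -/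
def polySubring {σ : Type*} (hA : IsGradedProj 𝒜 p 𝒜 p) (h1 : (1 : R) ∈ 𝒜 0)
    (d : (σ →₀ ℕ) →+ G) : Subring (MvPolynomial σ R) where
  carrier := {f | ∀ a, f.coeff a ∈ 𝒜 (d a)}
  zero_mem' a := by simp
  one_mem' a := by
    classical
    rw [MvPolynomial.coeff_one]
    split_ifs with h
    · simpa [← h] using h1
    · exact zero_mem _
  add_mem' hf hg a := by simpa using add_mem (hf a) (hg a)
  neg_mem' hf a := by simpa using hf a
  mul_mem' {f g} hf hg a := by
    classical
    rw [MvPolynomial.coeff_mul]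
    refine sum_mem fun x hx => ?_
    rw [← Finset.HasAntidiagonal.mem_antidiagonal.1 hx, map_add]
    exact hA.mul_mem (hf _) (hg _)

theorem monomial_mem_polySubring {σ : Type*} (hA : IsGradedProj 𝒜 p 𝒜 p) (h1 : (1 : R) ∈ 𝒜 0)
    (d : (σ →₀ ℕ) →+ G) {a : σ →₀ ℕ} {r : R} (hr : r ∈ 𝒜 (d a)) :
    MvPolynomial.monomial a r ∈ hA.polySubring h1 d := fun b => by
  classical
  rw [MvPolynomial.coeff_monomial]
  split_ifs with h
  · exact h ▸ hr
  · exact zero_mem _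

theorem isNoetherianRing_polySubring {σ : Type*} [Finite σ] [IsNoetherianRing R]
    (hA : IsGradedProj 𝒜 p 𝒜 p) (h1 : (1 : R) ∈ 𝒜 0) (d : (σ →₀ ℕ) →+ G) :
    IsNoetherianRing (hA.polySubring h1 d) := by
  classical
  let φ (f : MvPolynomial σ R) : MvPolynomial σ R :=
    ∑ a ∈ f.support, MvPolynomial.monomial a (p (d a) (f.coeff a))
  have hφ (f : MvPolynomial σ R) (a) : (φ f).coeff a = p (d a) (f.coeff a) := by
    simp only [φ, MvPolynomial.coeff_sum, MvPolynomial.coeff_monomial, Finset.sum_ite_eq',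
      MvPolynomial.mem_support_iff]
    split_ifs with h
    · rfl
    · rw [not_not.1 h, map_zero]
  let ρ : MvPolynomial σ R →+ MvPolynomial σ R :=
    { toFun := φ
      map_zero' := MvPolynomial.ext _ _ fun a => by simp [hφ]
      map_add' := fun f g => MvPolynomial.ext _ _ fun a => by simp [hφ] }
  have hρ (f : MvPolynomial σ R) (a) : (ρ f).coeff a = p (d a) (f.coeff a) := hφ f a
  have hρ_mem (f : MvPolynomial σ R) : ρ f ∈ hA.polySubring h1 d := fun a => by
    rw [hρ]
    exact hA.mem _ _
  refine isNoetherian_of_retraction (P := MvPolynomial σ R)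
    (fun n : hA.polySubring h1 d => (n : MvPolynomial σ R))
    (ρ.codRestrict (hA.polySubring h1 d) hρ_mem)
    (fun n => Subtype.ext (MvPolynomial.ext _ _ fun a => ?_))
    fun f n => ⟨⟨ρ f, hρ_mem f⟩, Subtype.ext (MvPolynomial.ext _ _ fun a => ?_)⟩
  · exact (hρ _ a).trans (hA.eq_self _ _ (n.2 a))
  · change (ρ (f * n)).coeff a = (ρ f * n).coeff a
    rw [hρ, MvPolynomial.coeff_mul, MvPolynomial.coeff_mul, map_sum]
    refine Finset.sum_congr rfl fun x hx => ?_
    rw [← Finset.HasAntidiagonal.mem_antidiagonal.1 hx, map_add, hρ]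
    exact hA.smul_right _ _ _ _ (n.2 _)

/-- The sum of the pieces with degree in the range of `d` is a finitely generated `𝒜 0`-algebra. -/
theorem exists_finset_mem_subring_closure {σ : Type*} [Finite σ] [IsNoetherianRing R]
    (hA : IsGradedProj 𝒜 p 𝒜 p) (h1 : (1 : R) ∈ 𝒜 0) (d : (σ →₀ ℕ) →+ G) :
    ∃ F : Finset R, (∀ f ∈ F, ∃ a, f ∈ 𝒜 (d a)) ∧
      ∀ a, ∀ r ∈ 𝒜 (d a), r ∈ Subring.closure ((𝒜 0 : Set R) ∪ F) := by
  classical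
  have := hA.isNoetherianRing_polySubring h1 d
  let C := hA.polySubring h1 d
  let s : Set C := {c | ∃ a ≠ 0, ∃ r ∈ 𝒜 (d a), (c : MvPolynomial σ R) = .monomial a r}
  obtain ⟨t, hts, ht⟩ := (Submodule.fg_span_iff_fg_span_finset_subset (R := C) s).1
    (IsNoetherian.noetherian _)
  choose! e he0 r hr hc using fun c (hc : c ∈ t) => hts hc
  refine ⟨t.image r, fun f hf => ?_, fun a => ?_⟩
  · obtain ⟨c, hct, rfl⟩ := Finset.mem_image.1 hf
    exact ⟨_, hr c hct⟩
  · induction a using WellFoundedLT.induction with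
    | ind a ih =>
    intro x hx
    rcases eq_or_ne a 0 with rfl | ha
    · exact Subring.subset_closure (Or.inl (by simpa using hx))
    let c : C := ⟨.monomial a x, hA.monomial_mem_polySubring h1 d hx⟩
    have hcs : c ∈ Submodule.span C (t : Set C) := ht ▸ Submodule.subset_span ⟨a, ha, x, hx, rfl⟩
    obtain ⟨f, -, hf⟩ := Submodule.mem_span_finset.1 hcs
    have hx_eq : x = ∑ c ∈ t, if e c ≤ a then
        (f c : MvPolynomial σ R).coeff (a - e c) * r c else 0 := by
      have := congrArg (fun c : C => (c : MvPolynomial σ R).coeff a) hf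
      simp only [c, MvPolynomial.coeff_monomial, if_true] at this
      rw [← this, AddSubmonoidClass.coe_finsetSum, MvPolynomial.coeff_sum]
      refine Finset.sum_congr rfl fun c hct => ?_
      rw [← MvPolynomial.coeff_mul_monomial', ← hc c hct]
      rfl
    rw [hx_eq]
    refine sum_mem fun c hct => ?_
    split_ifs with hle
    · refine Subring.mul_mem _ (ih _ ?_ _ ((f c).2 _))
        (Subring.subset_closure (Or.inr (Finset.mem_coe.2 (Finset.mem_image_of_mem r hct))))
      refine lt_of_le_of_ne tsub_le_self fun h => he0 c hct ?_
      have := tsub_add_cancel_of_le hle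
      rwa [h, add_eq_left] at this
    · exact zero_mem _

/-- The sum of the graded pieces with degree in a submonoid, as a subring. -/
def sumSubring (hA : IsGradedProj 𝒜 p 𝒜 p) (h1 : (1 : R) ∈ 𝒜 0) (S : AddSubmonoid G) :
    Subring R :=
  Subring.mk' ((⨆ s ∈ S, 𝒜 s : AddSubgroup R) : Set R)
    { carrier := (⨆ s ∈ S, 𝒜 s : AddSubgroup R)
      one_mem' := (le_iSup₂_of_le 0 S.zero_mem le_rfl : 𝒜 0 ≤ ⨆ s ∈ S, 𝒜 s) h1
      mul_mem' := fun ha hb =>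
        smul_mem_biSup (ℳ := 𝒜) (T := (S : Set G)) (fun _ _ _ _ => hA.mul_mem)
          (fun _ hs _ ht => S.add_mem hs ht) ha hb }
    (⨆ s ∈ S, 𝒜 s : AddSubgroup R) rfl rfl

theorem mem_sumSubring (hA : IsGradedProj 𝒜 p 𝒜 p) (h1 : (1 : R) ∈ 𝒜 0) {S : AddSubmonoid G}
    {s : G} (hs : s ∈ S) {a : R} (ha : a ∈ 𝒜 s) : a ∈ hA.sumSubring h1 S :=
  (le_iSup₂_of_le s hs le_rfl : 𝒜 s ≤ ⨆ s ∈ S, 𝒜 s) ha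

section TrivSqZeroExt

variable [Module Rᵐᵒᵖ M] [IsCentralScalar R M]

/-- The grading of the trivial square-zero extension of `R` by `M`, with `M` shifted by `t`. -/
def tszGrading (𝒜 : G → AddSubgroup R) (ℳ : G → AddSubgroup M) (t g : G) :
    AddSubgroup (TrivSqZeroExt R M) where
  carrier := {x | x.fst ∈ 𝒜 g ∧ x.snd ∈ ℳ (g + t)}
  zero_mem' := ⟨zero_mem _, zero_mem _⟩
  add_mem' hx hy := ⟨add_mem hx.1 hy.1, add_mem hx.2 hy.2⟩
  neg_mem' hx := ⟨neg_mem hx.1, neg_mem hx.2⟩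

/-- The projections onto the pieces of `tszGrading`. -/
def tszProj (p : G → R →+ R) (q : G → M →+ M) (t g : G) :
    TrivSqZeroExt R M →+ TrivSqZeroExt R M where
  toFun x := (p g x.fst, q (g + t) x.snd)
  map_zero' := Prod.ext (map_zero _) (map_zero _)
  map_add' _ _ := Prod.ext (map_add _ _ _) (map_add _ _ _)

theorem trivSqZeroExt (hA : IsGradedProj 𝒜 p 𝒜 p) (hM : IsGradedProj 𝒜 p ℳ q) (t : G) :
    IsGradedProj (tszGrading 𝒜 ℳ t) (tszProj p q t) (tszGrading 𝒜 ℳ t) (tszProj p q t) := by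
  have mem_right (g h : G) (a x : TrivSqZeroExt R M) (hx : x ∈ tszGrading 𝒜 ℳ t h) :
      tszProj p q t (g + h) (a * x) = tszProj p q t g a * x := by
    refine TrivSqZeroExt.ext (hA.smul_right g h _ _ hx.1) ?_
    change q (g + h + t) (a.fst • x.snd + MulOpposite.op x.fst • a.snd) =
      p g a.fst • x.snd + MulOpposite.op x.fst • q (g + t) a.snd
    rw [op_smul_eq_smul, op_smul_eq_smul, map_add, add_assoc, hM.smul_right _ _ _ _ hx.2,
      add_left_comm, hM.smul_left _ _ _ hx.1]
  refine ⟨fun g x => ⟨hA.mem _ _, hM.mem _ _⟩, fun g x hx =>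
    TrivSqZeroExt.ext (hA.eq_self _ _ hx.1) (hM.eq_self _ _ hx.2), mem_right,
    fun g h a ha x => ?_⟩
  rw [smul_eq_mul, smul_eq_mul, mul_comm, add_comm, mem_right _ _ _ _ ha, mul_comm]

theorem isNoetherianRing_trivSqZeroExt [IsNoetherianRing R] [IsNoetherian R M] :
    IsNoetherianRing (TrivSqZeroExt R M) :=
  have : IsNoetherian R (TrivSqZeroExt R M) := inferInstanceAs (IsNoetherian R (R × M))
  isNoetherian_of_tower R this

end TrivSqZeroExt

/-- The sum of the pieces of `ℳ` with degree in a translate of the range of `d` is a finitely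
generated module. -/
theorem exists_finset_mem_span {σ : Type*} [Finite σ] [IsNoetherianRing R] [IsNoetherian R M]
    (hA : IsGradedProj 𝒜 p 𝒜 p) (hM : IsGradedProj 𝒜 p ℳ q) (h1 : (1 : R) ∈ 𝒜 0)
    (d : (σ →₀ ℕ) →+ G) (t : G) :
    ∃ F : Finset M, (∀ f ∈ F, ∃ a, f ∈ ℳ (d a + t)) ∧
      ∀ a, ∀ x ∈ ℳ (d a + t),
        x ∈ Submodule.span (hA.sumSubring h1 (AddMonoidHom.mrange d)) (F : Set M) := by
  classical
  let _ : Module Rᵐᵒᵖ M := Module.compHom _ ((RingHom.id R).fromOpposite mul_comm)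
  have : IsCentralScalar R M := ⟨fun _ _ => rfl⟩
  have := isNoetherianRing_trivSqZeroExt (R := R) (M := M)
  obtain ⟨F₀, hF₀, hF₀_eq⟩ := hA.exists_finset_piece hM h1 t
  obtain ⟨F, hF, hF_mem⟩ := (hA.trivSqZeroExt hM t).exists_finset_mem_subring_closure
    ⟨h1, zero_mem _⟩ d
  let A := hA.sumSubring h1 (AddMonoidHom.mrange d)
  let F' := F₀ ∪ F.image TrivSqZeroExt.snd
  let N := Submodule.span A (F' : Set M)
  let D : Subring (TrivSqZeroExt R M) :=
    { carrier := {x | x.fst ∈ A ∧ x.snd ∈ N}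
      zero_mem' := ⟨zero_mem _, zero_mem _⟩
      one_mem' := ⟨one_mem _, zero_mem _⟩
      add_mem' := fun hx hy => ⟨add_mem hx.1 hy.1, add_mem hx.2 hy.2⟩
      neg_mem' := fun hx => ⟨neg_mem hx.1, neg_mem hx.2⟩
      mul_mem' := fun hx hy => ⟨Subring.mul_mem _ hx.1 hy.1,
        add_mem (N.smul_mem ⟨_, hx.1⟩ hy.2) (N.smul_mem ⟨_, hy.1⟩ hx.2)⟩ }
  have hD : Subring.closure ((tszGrading 𝒜 ℳ t 0 : Set (TrivSqZeroExt R M)) ∪ F) ≤ D := by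
    refine Subring.closure_le.2 (Set.union_subset (fun x hx => ⟨?_, ?_⟩) fun x hx => ⟨?_, ?_⟩)
    · exact hA.mem_sumSubring h1 (zero_mem _) hx.1
    · have hx' : x.snd ∈ (ℳ t : Set M) := by simpa using hx.2
      rw [hF₀_eq] at hx'
      refine (AddSubgroup.closure_le N.toAddSubgroup).2 ?_ hx'
      rintro _ ⟨a, ha, f, hf, rfl⟩
      exact N.smul_mem ⟨a, hA.mem_sumSubring h1 (zero_mem _) ha⟩
        (Submodule.subset_span (Finset.mem_union_left _ hf))
    · obtain ⟨a, ha⟩ := hF x hx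
      exact hA.mem_sumSubring h1 (AddMonoidHom.mem_mrange.2 ⟨a, rfl⟩) ha.1
    · exact Submodule.subset_span (Finset.mem_union_right _ (Finset.mem_image_of_mem _ hx))
  refine ⟨F', fun f hf => ?_, fun a x hx => ?_⟩
  · rcases Finset.mem_union.1 hf with hf | hf
    · exact ⟨0, by simpa using hF₀ hf⟩
    · obtain ⟨y, hy, rfl⟩ := Finset.mem_image.1 hf
      obtain ⟨a, ha⟩ := hF y hy
      exact ⟨a, ha.2⟩
  · exact (hD (hF_mem a (TrivSqZeroExt.inr x) ⟨zero_mem _, hx⟩)).2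

end IsGradedProj

/-- Theorem: finite generation of graded subalgebras and submodules.
Let `G` be a finitely generated abelian group, `R` a Noetherian `G`-graded commutative
ring (with grading `𝒜`), `M` a finitely generated `G`-graded `R`-module (with grading
`ℳ`), `S ⊆ G` a finitely generated subsemigroup and `T ⊆ G` a finitely generated
`S`-module.  Then: (a) `R_0` is Noetherian and each component `ℳ g` is a finitely
generated `R_0`-module; (b) `A = ⊕_{s ∈ S} R_s` is a finitely generated `R_0`-algebra;
(c) `N = ⊕_{t ∈ T} M_t` is a finitely generated `A`-module. -/
theorem graded_finite_generation
    {G : Type*} [AddCommGroup G] [AddGroup.FG G] [DecidableEq G]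
    {R : Type*} [CommRing R] [IsNoetherianRing R]
    (𝒜 : G → AddSubgroup R)
    (h1 : (1 : R) ∈ 𝒜 0)
    (hmul : ∀ (g h : G) (a b : R), a ∈ 𝒜 g → b ∈ 𝒜 h → a * b ∈ 𝒜 (g + h))
    (hdecomp : DirectSum.IsInternal fun g : G => 𝒜 g)
    {M : Type*} [AddCommGroup M] [Module R M] [Module.Finite R M]
    (ℳ : G → AddSubgroup M)
    (hsmul : ∀ (g h : G) (a : R) (x : M), a ∈ 𝒜 g → x ∈ ℳ h → a • x ∈ ℳ (g + h))
    (hMdecomp : DirectSum.IsInternal fun g : G => ℳ g)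
    (S : AddSubmonoid G) (hSfg : S.FG)
    (T : Set G)
    (hTmod : ∀ s ∈ S, ∀ t ∈ T, s + t ∈ T)
    (hTfg : ∃ ts : Finset G, T = ⋃ t ∈ ts, (fun s => s + t) '' (S : Set G)) :
    IsNoetherianRing ↥(zeroSubring 𝒜 h1 hmul) ∧
    (∀ g : G, ∃ F : Finset M, (↑F : Set M) ⊆ ℳ g ∧
      (ℳ g : Set M) =
        ↑(AddSubgroup.closure {y : M | ∃ a ∈ 𝒜 0, ∃ f ∈ F, y = a • f})) ∧
    (∃ F : Finset R, (↑F : Set R) ⊆ ((⨆ s ∈ S, 𝒜 s : AddSubgroup R) : Set R) ∧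
      ((⨆ s ∈ S, 𝒜 s : AddSubgroup R) : Set R) =
        ↑(Subring.closure ((𝒜 0 : Set R) ∪ ↑F))) ∧
    (∃ F : Finset M, (↑F : Set M) ⊆ ((⨆ t ∈ T, ℳ t : AddSubgroup M) : Set M) ∧
      ((⨆ t ∈ T, ℳ t : AddSubgroup M) : Set M) =
        ↑(AddSubgroup.closure
          {y : M | ∃ a ∈ (⨆ s ∈ S, 𝒜 s : AddSubgroup R), ∃ f ∈ F, y = a • f})) := by
  obtain ⟨p, hp_mem, hp, hp0⟩ := exists_projections 𝒜 hdecomp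
  obtain ⟨q, hq_mem, hq, hq0⟩ := exists_projections ℳ hMdecomp
  have hA : IsGradedProj 𝒜 p 𝒜 p :=
    isGradedProj_of_isInternal hmul hdecomp hdecomp hp hp0 hp_mem hp hp0
  have hM : IsGradedProj 𝒜 p ℳ q :=
    isGradedProj_of_isInternal hsmul hdecomp hMdecomp hp hp0 hq_mem hq hq0
  obtain ⟨n, d, rfl⟩ := hSfg.exists_mrange_eq
  refine ⟨hA.isNoetherianRing_zeroSubring h1 hmul, hA.exists_finset_piece hM h1, ?_, ?_⟩
  · obtain ⟨F, hF, hF_mem⟩ := hA.exists_finset_mem_subring_closure h1 d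
    have hFA : (F : Set R) ⊆ hA.sumSubring h1 (AddMonoidHom.mrange d) := fun f hf =>
      have ⟨a, ha⟩ := hF f hf
      hA.mem_sumSubring h1 (AddMonoidHom.mem_mrange.2 ⟨a, rfl⟩) ha
    refine ⟨F, hFA, Set.Subset.antisymm ?_ ?_⟩
    · refine (iSup₂_le ?_ : _ ≤ (Subring.closure ((𝒜 0 : Set R) ∪ F)).toAddSubgroup)
      rintro _ ⟨a, rfl⟩
      exact hF_mem a
    · exact (Subring.closure_le (t := hA.sumSubring h1 (AddMonoidHom.mrange d))).2
        (Set.union_subset (fun _ hx => hA.mem_sumSubring h1 (zero_mem _) hx) hFA)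
  · obtain ⟨ts, hts⟩ := hTfg
    choose F hF hF_mem using hA.exists_finset_mem_span hM h1 d
    classical
    have hFN : (ts.biUnion F : Set M) ⊆ (⨆ t ∈ T, ℳ t : AddSubgroup M) := fun f hf => by
      obtain ⟨t, ht, hft⟩ := Finset.mem_biUnion.1 hf
      obtain ⟨a, ha⟩ := hF t f hft
      have haT : d a + t ∈ T := by
        rw [hts]
        exact Set.mem_biUnion ht ⟨d a, ⟨a, rfl⟩, rfl⟩
      exact (le_iSup₂_of_le _ haT le_rfl : ℳ (d a + t) ≤ ⨆ t ∈ T, ℳ t) ha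
    refine ⟨ts.biUnion F, hFN, Set.Subset.antisymm ?_ ?_⟩
    · refine Set.Subset.trans ?_
        (span_subring_eq_closure (hA.sumSubring h1 (AddMonoidHom.mrange d)) _).subset
      refine (iSup₂_le ?_ : _ ≤ (Submodule.span (hA.sumSubring h1 (AddMonoidHom.mrange d))
        (ts.biUnion F : Set M)).toAddSubgroup)
      intro g hg x hx
      rw [hts] at hg
      obtain ⟨t, ht, _, ⟨a, rfl⟩, rfl⟩ := Set.mem_iUnion₂.1 hg
      exact Submodule.span_mono (Finset.coe_subset.2 (Finset.subset_biUnion_of_mem F ht))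
        (hF_mem t a x hx)
    · refine (AddSubgroup.closure_le _).2 ?_
      rintro _ ⟨a, ha, f, hf, rfl⟩
      exact smul_mem_biSup hsmul hTmod ha (hFN hf)
end
end

section
/- Let S and S' be finitely generated submonoids of ℤ^m, T ⊆ ℤ^m a finitely generated S-module (S + T ⊆ T and T is a union of finitely many translates of S), and T' ⊆ ℤ^m a finitely generated S'-module. Then S ∩ S' is a finitely generated submonoid of ℤ^m, and T ∩ T' is a finitely generated (S ∩ S')-module. -/
set_option synthInstance.maxHeartbeats 1000000
set_option maxHeartbeats 1000000

open scoped BigOperators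

noncomputable section

/-- The intersection of two finitely generated submonoids of a cancellative commutative monoid is
finitely generated. -/
theorem AddSubmonoid.FG.inf_of_isCancelAdd {M : Type*} [AddCommMonoid M] [IsCancelAdd M]
    {S S' : AddSubmonoid M} (hS : S.FG) (hS' : S'.FG) : (S ⊓ S').FG := by
  obtain ⟨n, f, rfl⟩ := fg_iff_exists_fin_addMonoidHom.1 hS
  obtain ⟨k, g, rfl⟩ := fg_iff_exists_fin_addMonoidHom.1 hS'
  let f' : (Fin n → ℕ) × (Fin k → ℕ) →+ M := f.comp (AddMonoidHom.fst _ _)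
  let g' : (Fin n → ℕ) × (Fin k → ℕ) →+ M := g.comp (AddMonoidHom.snd _ _)
  convert (AddSubmonoid.fg_eqLocusM f' g').map f'
  ext x
  simp only [AddSubmonoid.mem_inf, AddMonoidHom.mem_mrange, AddSubmonoid.mem_map]
  constructor
  · rintro ⟨⟨a, rfl⟩, b, hb⟩
    exact ⟨(a, b), hb.symm, rfl⟩
  · rintro ⟨⟨a, b⟩, hab, rfl⟩
    exact ⟨⟨a, rfl⟩, b, Eq.symm hab⟩

/-- The intersection of translates of two finitely generated submonoids of a commutative group is
a finite union of translates of the intersection of the submonoids. -/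
theorem AddSubmonoid.FG.exists_finset_mem_iff_sub_mem_inf {G : Type*} [AddCommGroup G]
    {S S' : AddSubmonoid G} (hS : S.FG) (hS' : S'.FG) (t t' : G) :
    ∃ F : Finset G, ∀ x, (x - t ∈ S ∧ x - t' ∈ S') ↔ ∃ u ∈ F, x - u ∈ S ⊓ S' := by
  classical
  obtain ⟨n, f, rfl⟩ := fg_iff_exists_fin_addMonoidHom.1 hS
  obtain ⟨k, g, rfl⟩ := fg_iff_exists_fin_addMonoidHom.1 hS'
  let X : Set ((Fin n → ℕ) × (Fin k → ℕ)) := {p | f p.1 + t = g p.2 + t'}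
  have hpwo : X.IsPWO := Set.isPWO_of_wellQuasiOrderedLE X
  have hfin : {p | Minimal (· ∈ X) p}.Finite :=
    (setOfPred_minimal_antichain _).finite_of_partiallyWellOrderedOn
      (hpwo.mono (setOfPred_minimal_subset _))
  refine ⟨hfin.toFinset.image fun p => f p.1 + t, fun x => ?_⟩
  simp only [Finset.mem_image, Set.Finite.mem_toFinset, exists_exists_and_eq_and,
    AddSubmonoid.mem_inf, AddMonoidHom.mem_mrange]
  constructor
  · rintro ⟨⟨a, ha⟩, b, hb⟩
    have hab : (a, b) ∈ X := by
      change f a + t = g b + t'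
      rw [ha, hb, sub_add_cancel, sub_add_cancel]
    obtain ⟨p, hp, hmin⟩ := hpwo.exists_le_minimal hab
    have hpX : f p.1 + t = g p.2 + t' := hmin.prop
    obtain ⟨⟨c, d⟩, hcd⟩ := exists_add_of_le hp
    obtain ⟨rfl, rfl⟩ := Prod.mk.inj hcd
    rw [map_add] at ha hb
    refine ⟨p, hmin, ⟨c, ?_⟩, d, ?_⟩
    · rw [← sub_sub, sub_right_comm, ← ha, add_sub_cancel_left]
    · rw [hpX, ← sub_sub, sub_right_comm, ← hb, add_sub_cancel_left]
  · rintro ⟨p, hp, ⟨c, hc⟩, d, hd⟩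
    have hpX : f p.1 + t = g p.2 + t' := hp.prop
    refine ⟨⟨p.1 + c, ?_⟩, p.2 + d, ?_⟩
    · rw [map_add, hc]
      abel
    · rw [map_add, hd, hpX]
      abel

theorem AddSubmonoid.mem_biUnion_translate_iff {G : Type*} [AddCommGroup G] (S : AddSubmonoid G)
    (F : Finset G) (x : G) :
    x ∈ ⋃ t ∈ F, (fun s => s + t) '' (S : Set G) ↔ ∃ t ∈ F, x - t ∈ S := by
  simp [sub_eq_add_neg]

/-- Corollary: intersections of affine semigroups and their modules.
Let `S, S'` be affine semigroups (finitely generated submonoids) of `ℤ^m`, `T` a finitely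
generated `S`-module and `T'` a finitely generated `S'`-module (both inside `ℤ^m`).  Then
`S ∩ S'` is an affine semigroup and `T ∩ T'` is a finitely generated `S ∩ S'`-module. -/
theorem intersection_of_semigroup_modules_fg
    {m : ℕ}
    (S S' : AddSubmonoid (Fin m → ℤ)) (hS : S.FG) (hS' : S'.FG)
    (T T' : Set (Fin m → ℤ))
    (hT : ∀ s ∈ S, ∀ t ∈ T, s + t ∈ T)
    (hT' : ∀ s ∈ S', ∀ t ∈ T', s + t ∈ T')
    (hTfg : ∃ F : Finset (Fin m → ℤ), T = ⋃ t ∈ F, (fun s => s + t) '' (S : Set (Fin m → ℤ)))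
    (hT'fg : ∃ F : Finset (Fin m → ℤ),
      T' = ⋃ t ∈ F, (fun s => s + t) '' (S' : Set (Fin m → ℤ))) :
    (S ⊓ S').FG ∧
    ∃ F : Finset (Fin m → ℤ),
      T ∩ T' = ⋃ t ∈ F, (fun s => s + t) '' ((S ⊓ S' : AddSubmonoid (Fin m → ℤ)) :
        Set (Fin m → ℤ)) := by
  classical
  refine ⟨hS.inf_of_isCancelAdd hS', ?_⟩
  obtain ⟨F, rfl⟩ := hTfg
  obtain ⟨F', rfl⟩ := hT'fg
  choose U hU using hS.exists_finset_mem_iff_sub_mem_inf hS'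
  refine ⟨F.biUnion fun t => F'.biUnion (U t), ?_⟩
  ext x
  rw [Set.mem_inter_iff]
  simp_rw [AddSubmonoid.mem_biUnion_translate_iff]
  simp only [Finset.mem_biUnion]
  constructor
  · rintro ⟨⟨t, ht, hx⟩, t', ht', hx'⟩
    obtain ⟨u, hu, hxu⟩ := (hU t t' x).1 ⟨hx, hx'⟩
    exact ⟨u, ⟨t, ht, t', ht', hu⟩, hxu⟩
  · rintro ⟨u, ⟨t, ht, t', ht', hu⟩, hxu⟩
    obtain ⟨hx, hx'⟩ := (hU t t' x).2 ⟨u, hu, hxu⟩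
    exact ⟨⟨t, ht, hx⟩, t', ht', hx'⟩
end
end

section
/- Let K be a field, G a finitely generated abelian group, R a Noetherian G-graded commutative K-algebra such that R_0 is a finitely generated K-algebra, and M a finitely generated G-graded R-module. Let S be a finitely generated subsemigroup of G containing deg r for every nonzero homogeneous r ∈ R, and T a finitely generated S-submodule of G containing deg x for every nonzero homogeneous x ∈ M. Define the Hilbert function H(M,t) = dim_K M_t for t ∈ G. Suppose that lim_{k→∞} H(M, kc + d) = ∞ for every c ∈ S that is not a torsion element of G and every d ∈ T. Then for every C ∈ ℤ_+ the set {t ∈ T : H(M,t) ≤ C} is finite. -/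
set_option synthInstance.maxHeartbeats 1000000
set_option maxHeartbeats 1000000

open scoped BigOperators DirectSum

noncomputable section

/-- A submonoid of a finitely generated abelian group whose ideals are finitely generated is
itself finitely generated. -/
lemma AddSubmonoid.fg_of_forall_subset_exists_finite {G : Type*} [AddCommGroup G] [AddGroup.FG G]
    (P : AddSubmonoid G)
    (hP : ∀ X : Set G, X ⊆ P → ∃ F : Set G, F.Finite ∧ F ⊆ X ∧ ∀ x ∈ X, ∃ f ∈ F, x - f ∈ P) :
    P.FG := by
  have : Module.Finite ℤ G := Module.Finite.iff_addGroup_fg.mpr ‹_›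
  let U : AddSubgroup G :=
    { carrier := {g | g ∈ P ∧ -g ∈ P}
      zero_mem' := by simp
      add_mem' := fun {a b} ha hb => ⟨P.add_mem ha.1 hb.1, by
        rw [neg_add]; exact P.add_mem ha.2 hb.2⟩
      neg_mem' := fun {a} ha => ⟨ha.2, by rw [neg_neg]; exact ha.1⟩ }
  have hU : U.toAddSubmonoid.FG := by
    rw [← AddSubgroup.fg_iff_addSubmonoid_fg]
    have := (Submodule.fg_iff_addSubgroup_fg (AddSubgroup.toIntSubmodule U)).1
      (IsNoetherian.noetherian _)
    simpa using this
  obtain ⟨F, hF, hFX, hXF⟩ := hP {g | g ∈ P ∧ -g ∉ P} fun g hg => hg.1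
  have hfg : (U.toAddSubmonoid ⊔ AddSubmonoid.closure F).FG :=
    hU.sup ((AddSubmonoid.fg_iff _).2 ⟨F, rfl, hF⟩)
  convert hfg
  apply le_antisymm
  · by_contra hnot
    obtain ⟨y, hyP, hy⟩ := Set.not_subset.1 hnot
    obtain ⟨E, hE, hEY, hYE⟩ :=
      hP {g | g ∈ P ∧ g ∉ U.toAddSubmonoid ⊔ AddSubmonoid.closure F} fun g hg => hg.1
    let : Preorder G :=
      { le := fun a b => b - a ∈ P
        le_refl := fun a => by simp
        le_trans := fun a b c hab hbc => by simpa using P.add_mem hbc hab }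
    obtain ⟨e, he, -⟩ := hYE y ⟨hyP, hy⟩
    obtain ⟨m, hmE, hm⟩ := hE.exists_minimal ⟨e, he⟩
    obtain ⟨hmP, hm'⟩ := hEY hmE
    obtain ⟨f, hf, hfm⟩ := hXF m ⟨hmP, fun h => hm' (AddSubmonoid.mem_sup_left ⟨hmP, h⟩)⟩
    obtain ⟨e', he', hp⟩ := hYE (m - f) ⟨hfm, fun h => hm' (by
      simpa using add_mem h (AddSubmonoid.mem_sup_right (AddSubmonoid.subset_closure hf)))⟩
    have h1 : e' ≤ m := by
      change m - e' ∈ P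
      have := P.add_mem hp (hFX hf).1
      convert this using 1
      abel
    have h2 : e' - m ∈ P := hm he' h1
    refine (hFX hf).2 ?_
    have := P.add_mem h2 hp
    convert this using 1
    abel
  · refine sup_le (fun g hg => hg.1) ?_
    rw [AddSubmonoid.closure_le]
    exact fun g hg => (hFX hg).1

/-- An infinite semilinear set in a finitely generated abelian group contains a ray whose direction
is not torsion. -/
lemma IsSemilinearSet.exists_ray_of_infinite {G : Type*} [AddCommGroup G] [AddGroup.FG G]
    {A : Set G} (hA : IsSemilinearSet A) (hinf : A.Infinite) :
    ∃ a c : G, (∀ k : ℕ, 0 < k → k • c ≠ 0) ∧ ∀ k : ℕ, k • c + a ∈ A := by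
  have : Module.Finite ℤ G := Module.Finite.iff_addGroup_fg.mpr ‹_›
  obtain ⟨L, hL, hlin, rfl⟩ := hA
  obtain ⟨s, hs, hsinf⟩ : ∃ s ∈ L, s.Infinite := by
    by_contra! h
    exact hinf (hL.sUnion h)
  obtain ⟨a, t, ht, rfl⟩ := hlin s hs
  obtain ⟨c, hct, hc⟩ : ∃ c ∈ t, ¬ IsOfFinAddOrder c := by
    by_contra! h
    have hfg : AddGroup.FG (AddCommGroup.torsion G) := by
      rw [AddGroup.fg_iff_addSubgroup_fg]
      have := (Submodule.fg_iff_addSubgroup_fg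
        (AddSubgroup.toIntSubmodule (AddCommGroup.torsion G))).1 (IsNoetherian.noetherian _)
      simpa using this
    have hfin : Finite (AddCommGroup.torsion G) :=
      AddCommGroup.finite_of_fg_isAddTorsion _ (AddCommMonoid.addTorsion.isAddTorsion)
    refine hsinf (Set.Finite.vadd_set (Set.Finite.subset
      (Set.toFinite ((AddCommGroup.torsion G : AddSubgroup G) : Set G)) ?_))
    have : AddSubmonoid.closure t ≤ (AddCommGroup.torsion G).toAddSubmonoid :=
      AddSubmonoid.closure_le.2 h
    exact this
  refine ⟨a, c, fun k hk h => hc (isOfFinAddOrder_iff_nsmul_eq_zero.2 ⟨k, hk, h⟩), fun k => ?_⟩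
  refine ⟨_, hs, k • c, ?_, by simp [add_comm]⟩
  exact nsmul_mem (AddSubmonoid.subset_closure hct) k

/-- If a finite union of translates of a finitely generated submonoid contains a ray, then the
submonoid contains a positive multiple of the direction of the ray. -/
lemma AddSubmonoid.FG.exists_nsmul_mem_of_ray {G : Type*} [AddCommGroup G]
    {S : AddSubmonoid G} (hS : S.FG) {ts : Finset G} {a c : G}
    (h : ∀ k : ℕ, ∃ t ∈ ts, k • c + a - t ∈ S) : ∃ m : ℕ, 0 < m ∧ m • c ∈ S := by
  obtain ⟨n, φ, rfl⟩ := AddSubmonoid.fg_iff_exists_fin_addMonoidHom.1 hS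
  choose t ht v hv using h
  have hwqo : WellQuasiOrdered fun x y : ts × (Fin n → ℕ) => x.1 = y.1 ∧ x.2 ≤ y.2 :=
    (Finite.wellQuasiOrdered _).prod wellQuasiOrdered_le
  obtain ⟨i, j, hij, h1, h2⟩ := hwqo fun k => (⟨t k, ht k⟩, v k)
  refine ⟨j - i, Nat.sub_pos_of_lt hij, v j - v i, ?_⟩
  have h3 : φ (v j - v i) + φ (v i) = φ (v j) := by rw [← map_add, tsub_add_cancel_of_le h2]
  have h4 : t i = t j := congrArg Subtype.val h1
  rw [hv, hv, h4] at h3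
  rw [sub_nsmul _ hij.le, eq_sub_of_add_eq h3]
  abel

/-- The sublevel sets of a sum of two functions are semilinear if those of the summands are. -/
lemma isSemilinearSet_add_le {G : Type*} [AddCommMonoid G] {f g : G → Cardinal}
    (hf : ∀ C : ℕ, IsSemilinearSet {t | f t ≤ C}) (hg : ∀ C : ℕ, IsSemilinearSet {t | g t ≤ C})
    (C : ℕ) : IsSemilinearSet {t | f t + g t ≤ C} := by
  have : {t | f t + g t ≤ C} =
      ⋃ p ∈ Finset.HasAntidiagonal.antidiagonal C, {t | f t ≤ (p.1 : ℕ)} ∩ {t | g t ≤ (p.2 : ℕ)} := by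
    ext t
    simp only [Set.mem_iUnion, Finset.HasAntidiagonal.mem_antidiagonal, exists_prop, Set.mem_inter_iff,
      Set.mem_ofPred_eq, Prod.exists]
    constructor
    · intro h
      obtain ⟨a, ha⟩ := Cardinal.lt_aleph0.1
        ((self_le_add_right _ _).trans_lt (h.trans_lt (Cardinal.natCast_lt_aleph0)))
      obtain ⟨b, hb⟩ := Cardinal.lt_aleph0.1
        ((self_le_add_left _ _).trans_lt (h.trans_lt (Cardinal.natCast_lt_aleph0)))
      rw [ha, hb] at h ⊢
      norm_cast at h ⊢
      exact ⟨a, C - a, by omega, le_rfl, by omega⟩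
    · rintro ⟨a, b, rfl, ha, hb⟩
      push_cast
      exact add_le_add ha hb
  rw [this]
  exact .biUnion_finset fun p _ => (hf _).inter (hg _)

universe v

lemma Submodule.rank_map_add_rank_inf_ker {K : Type*} {V W : Type v} [Field K] [AddCommGroup V]
    [Module K V] [AddCommGroup W] [Module K W] (A : Submodule K V) (π : V →ₗ[K] W) :
    Module.rank K (A.map π) + Module.rank K ↥(A ⊓ LinearMap.ker π) = Module.rank K A := by
  rw [← (π.domRestrict A).rank_range_add_rank_ker, LinearMap.range_domRestrict,
    LinearMap.ker_domRestrict, ← Submodule.map_comap_subtype]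
  congr 1
  exact (LinearEquiv.rank_eq (Submodule.equivSubtypeMap A _)).symm

section Graded

variable {K G R M : Type*} [Field K] [AddCommGroup G] [DecidableEq G] [CommRing R] [Algebra K R]
  [AddCommGroup M] [Module K M] [Module R M] [IsScalarTower K R M]
  (𝒜 : G → Submodule K R) (ℳ : G → Submodule K M)

open DirectSum

omit [IsScalarTower K R M] in
lemma coe_decompose_smul_of_mem [Decomposition 𝒜] [Decomposition ℳ]
    (hsmul : ∀ (g h : G) (a : R) (x : M), a ∈ 𝒜 g → x ∈ ℳ h → a • x ∈ ℳ (g + h))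
    {d : G} {x : M} (hx : x ∈ ℳ d) (r : R) (t : G) :
    (decompose ℳ (r • x) t : M) = (decompose 𝒜 r (t - d) : R) • x := by
  induction r using Decomposition.inductionOn 𝒜 with
  | zero => simp
  | @homogeneous i m =>
    have hm := hsmul i d m x m.2 hx
    by_cases h : i = t - d
    · subst h
      rw [sub_add_cancel] at hm
      rw [decompose_of_mem_same ℳ hm, decompose_of_mem_same 𝒜 m.2]
    · rw [decompose_of_mem_ne ℳ hm fun h' => h (eq_sub_of_add_eq h'),
        decompose_of_mem_ne 𝒜 m.2 h, zero_smul]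
  | add a b ha hb => simp [add_smul, ha, hb]

/-- The degrees of the homogeneous elements outside an ideal of a Noetherian graded ring satisfy
the ascending chain condition. -/
lemma exists_finite_degrees_of_notMem_ideal [IsNoetherianRing R] [Decomposition 𝒜]
    (hmul : ∀ (g h : G) (a b : R), a ∈ 𝒜 g → b ∈ 𝒜 h → a * b ∈ 𝒜 (g + h))
    (P : Ideal R) (X : Set G) (hX : ∀ g ∈ X, ∃ a ∈ 𝒜 g, a ∉ P) :
    ∃ F : Set G, F.Finite ∧ F ⊆ X ∧ ∀ x ∈ X, ∃ f ∈ F, ∃ b ∈ 𝒜 (x - f), b ∉ P := by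
  classical
  choose! a ha haP using hX
  obtain ⟨s, hs, hspan⟩ := (Submodule.fg_span_iff_fg_span_finset_subset (R := R) (a '' X)).1
    (IsNoetherian.noetherian _)
  obtain ⟨F, hF, rfl⟩ := Finset.subset_set_image_iff.1 hs
  refine ⟨F, F.finite_toSet, hF, fun x hx => ?_⟩
  by_contra! hcon
  have hmem : a x ∈ Submodule.span R ((F.image a : Finset R) : Set R) :=
    hspan ▸ Submodule.subset_span ⟨x, hx, rfl⟩
  have key : ∀ r ∈ Submodule.span R ((F.image a : Finset R) : Set R),
      ∀ c : R, (decompose 𝒜 (c * r) x : R) ∈ P := by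
    intro r hr
    induction hr using Submodule.span_induction with
    | mem r hr =>
      obtain ⟨f, hf, rfl⟩ := Finset.mem_image.1 (Finset.mem_coe.1 hr)
      intro c
      rw [← smul_eq_mul, coe_decompose_smul_of_mem 𝒜 𝒜 hmul (ha f (hF hf)), smul_eq_mul]
      exact P.mul_mem_right _ (hcon f hf _ (SetLike.coe_mem _))
    | zero => simp
    | add r r' _ _ h h' =>
      intro c
      simpa [mul_add] using P.add_mem (h c) (h' c)
    | smul b r _ h =>
      intro c
      simpa [mul_assoc] using h (c * b)
  refine haP x hx ?_
  simpa [decompose_of_mem_same 𝒜 (ha x hx)] using key _ hmem 1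

omit [IsScalarTower K R M] in
/-- A homogeneous element outside a homogeneous submodule `N` can be chosen such that the
homogeneous elements outside its annihilator modulo `N` are closed under multiplication. -/
lemma exists_homogeneous_notMem_of_ne_top [IsNoetherianRing R] [Decomposition ℳ]
    (hsmul : ∀ (g h : G) (a : R) (x : M), a ∈ 𝒜 g → x ∈ ℳ h → a • x ∈ ℳ (g + h))
    {N : Submodule R M} (hN : N ≠ ⊤) :
    ∃ d : G, ∃ x ∈ ℳ d, x ∉ N ∧ ∀ (h : G) (a b : R), b ∈ 𝒜 h →
      (a * b) • x ∈ N → a • x ∈ N ∨ b • x ∈ N := by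
  obtain ⟨d, x, hx, hxN⟩ : ∃ d : G, ∃ x ∈ ℳ d, x ∉ N := by
    by_contra! h
    refine hN (eq_top_iff.2 fun m _ => ?_)
    induction m using Decomposition.inductionOn ℳ with
    | zero => exact N.zero_mem
    | @homogeneous i m => exact h i m m.2
    | add a b ha hb => exact N.add_mem (ha trivial) (hb trivial)
  obtain ⟨I, ⟨d, x, hx, hxN, rfl⟩, hmax⟩ := (wellFounded_gt (α := Ideal R)).has_min
    {I | ∃ d : G, ∃ x ∈ ℳ d, x ∉ N ∧ I = N.comap (LinearMap.toSpanSingleton R M x)}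
    ⟨_, d, x, hx, hxN, rfl⟩
  refine ⟨d, x, hx, hxN, fun h a b hb hab => ?_⟩
  by_contra! hcon
  refine hmax _ ⟨h + d, b • x, hsmul h d b x hb hx, hcon.2, rfl⟩ ?_
  refine lt_of_le_not_ge (fun r hr => ?_) fun hle => hcon.1 ?_
  · have hr : r • x ∈ N := hr
    change r • b • x ∈ N
    rw [smul_comm]
    exact N.smul_mem b hr
  · exact hle (x := a) (by
      change a • b • x ∈ N
      rwa [← mul_smul])

/-- The sublevel sets of the Hilbert function of the cyclic submodule of `M ⧸ N` generated by `x`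
are semilinear when the homogeneous elements outside the annihilator of `x` modulo `N` are closed
under multiplication. -/
lemma isSemilinearSet_rank_map_toSpanSingleton_le [AddGroup.FG G] [IsNoetherianRing R]
    [Decomposition 𝒜] (h1 : (1 : R) ∈ 𝒜 0)
    (hmul : ∀ (g h : G) (a b : R), a ∈ 𝒜 g → b ∈ 𝒜 h → a * b ∈ 𝒜 (g + h))
    {N : Submodule R M} {x : M} (hxN : x ∉ N)
    (hprime : ∀ (h : G) (a b : R), b ∈ 𝒜 h → (a * b) • x ∈ N → a • x ∈ N ∨ b • x ∈ N) (C : ℕ) :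
    IsSemilinearSet {s : G | Module.rank K ((𝒜 s).map
      ((LinearMap.toSpanSingleton R (M ⧸ N) (N.mkQ x)).restrictScalars K)) ≤ C} := by
  have : AddMonoid.FG G := AddGroup.fg_iff_addMonoid_fg.1 ‹_›
  set ψ := (LinearMap.toSpanSingleton R (M ⧸ N) (N.mkQ x)).restrictScalars K with hψ
  have hψ_apply : ∀ r : R, ψ r = N.mkQ (r • x) := fun r => by simp [hψ]
  have hψ_zero : ∀ r : R, ψ r = 0 ↔ r • x ∈ N := fun r => by
    rw [hψ_apply, Submodule.mkQ_apply, Submodule.Quotient.mk_eq_zero]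
  let P : Ideal R := N.comap (LinearMap.toSpanSingleton R M x)
  let D : AddSubmonoid G :=
    { carrier := {g | ∃ a ∈ 𝒜 g, a • x ∉ N}
      zero_mem' := ⟨1, h1, by rwa [one_smul]⟩
      add_mem' := by
        rintro g h ⟨a, ha, haN⟩ ⟨b, hb, hbN⟩
        refine ⟨a * b, hmul g h a b ha hb, fun hab => ?_⟩
        exact (hprime h a b hb hab).elim haN hbN }
  have hfin : ∀ X : Set G, X ⊆ D →
      ∃ F : Set G, F.Finite ∧ F ⊆ X ∧ ∀ x ∈ X, ∃ f ∈ F, x - f ∈ D := fun X hX =>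
    exists_finite_degrees_of_notMem_ideal 𝒜 hmul P X hX
  have hD : D.FG := D.fg_of_forall_subset_exists_finite hfin
  have hmono : ∀ g ∈ D, ∀ s : G,
      Module.rank K ((𝒜 s).map ψ) ≤ Module.rank K ((𝒜 (g + s)).map ψ) := by
    rintro g ⟨b, hb, hbN⟩ s
    let β : (M ⧸ N) →ₗ[K] (M ⧸ N) := (LinearMap.lsmul R (M ⧸ N) b).restrictScalars K
    have hβ : ∀ r, β (ψ r) = ψ (b * r) := fun r => by simp [β, hψ, mul_smul, smul_comm r b]
    have hmap : ∀ y ∈ (𝒜 s).map ψ, β y ∈ (𝒜 (g + s)).map ψ := by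
      rintro _ ⟨r, hr, rfl⟩
      exact ⟨b * r, hmul g s b r hb hr, (hβ r).symm⟩
    refine LinearMap.rank_le_of_injective (β.restrict hmap) ?_
    rw [← LinearMap.ker_eq_bot, LinearMap.ker_eq_bot']
    rintro ⟨_, r, hr, rfl⟩ h
    have h : β (ψ r) = 0 := congrArg Subtype.val h
    rw [hβ, hψ_zero] at h
    exact Subtype.ext ((hψ_zero r).2 ((hprime s b r hr h).resolve_left hbN))
  obtain ⟨F, hF, hFX, hXF⟩ := hfin {s | s ∈ D ∧ (C : Cardinal) < Module.rank K ((𝒜 s).map ψ)}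
    fun s hs => hs.1
  convert ((IsSemilinearSet.of_finite hF).add (IsSemilinearSet.of_fg hD)).compl using 1
  ext s
  rw [Set.mem_compl_iff, Set.mem_add, Set.mem_ofPred_eq, ← not_lt, not_iff_not]
  constructor
  · intro hs
    by_cases hsD : s ∈ D
    · obtain ⟨f, hf, hfs⟩ := hXF s ⟨hsD, hs⟩
      exact ⟨f, hf, s - f, hfs, by abel⟩
    · have hbot : (𝒜 s).map ψ = ⊥ := by
        rw [eq_bot_iff]
        rintro _ ⟨r, hr, rfl⟩
        rw [Submodule.mem_bot, hψ_zero]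
        by_contra hrN
        exact hsD ⟨r, hr, hrN⟩
      rw [hbot, rank_bot] at hs
      exact absurd hs (not_lt.2 zero_le)
  · rintro ⟨f, hf, g, hg, rfl⟩
    rw [add_comm]
    exact (hFX hf).2.trans_le (hmono g hg f)

/-- For every homogeneous submodule `N`, the sublevel sets of the Hilbert function of `M ⧸ N` are
semilinear. -/
lemma isSemilinearSet_rank_map_mkQ_le [AddGroup.FG G] [IsNoetherianRing R] [Module.Finite R M]
    [Decomposition 𝒜] [Decomposition ℳ] (h1 : (1 : R) ∈ 𝒜 0)
    (hmul : ∀ (g h : G) (a b : R), a ∈ 𝒜 g → b ∈ 𝒜 h → a * b ∈ 𝒜 (g + h))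
    (hsmul : ∀ (g h : G) (a : R) (x : M), a ∈ 𝒜 g → x ∈ ℳ h → a • x ∈ ℳ (g + h))
    (N : Submodule R M) (hN : SetLike.IsHomogeneous ℳ N) (C : ℕ) :
    IsSemilinearSet {t : G | Module.rank K ((ℳ t).map (N.mkQ.restrictScalars K)) ≤ C} := by
  have : AddMonoid.FG G := AddGroup.fg_iff_addMonoid_fg.1 ‹_›
  induction N using WellFoundedGT.induction generalizing C with
  | ind N ih =>
  by_cases htop : N = ⊤
  · subst htop
    have : Subsingleton (M ⧸ (⊤ : Submodule R M)) := Submodule.Quotient.subsingleton_iff.2 rfl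
    convert IsSemilinearSet.univ (M := G)
    simp [rank_subsingleton']
  obtain ⟨d, x, hx, hxN, hprime⟩ := exists_homogeneous_notMem_of_ne_top 𝒜 ℳ hsmul htop
  have hdec := coe_decompose_smul_of_mem 𝒜 ℳ hsmul hx
  set N' : Submodule R M := N ⊔ R ∙ x with hN'
  have hle : N ≤ N' := le_sup_left
  have hmem : ∀ {m}, m ∈ N' ↔ ∃ n ∈ N, ∃ r : R, n + r • x = m := by
    simp [hN', Submodule.mem_sup, Submodule.mem_span_singleton]
  have hlt : N < N' := lt_of_le_of_ne hle fun h =>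
    hxN (h ▸ hmem.2 ⟨0, N.zero_mem, 1, by simp⟩)
  have hhom : SetLike.IsHomogeneous ℳ N' := by
    intro t m hm
    obtain ⟨n, hn, r, rfl⟩ := hmem.1 hm
    refine hmem.2 ⟨_, hN t hn, decompose 𝒜 r (t - d), ?_⟩
    simp [hdec]
  have hquot := isSemilinearSet_rank_map_toSpanSingleton_le 𝒜 h1 hmul hxN hprime
  set ψ := (LinearMap.toSpanSingleton R (M ⧸ N) (N.mkQ x)).restrictScalars K
  set π : (M ⧸ N) →ₗ[K] (M ⧸ N') := (Submodule.factor hle).restrictScalars K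
  have hmap : ∀ t, ((ℳ t).map (N.mkQ.restrictScalars K)).map π =
      (ℳ t).map (N'.mkQ.restrictScalars K) := fun t => by
    rw [← Submodule.map_comp]
    rfl
  have hker : ∀ t, (ℳ t).map (N.mkQ.restrictScalars K) ⊓ LinearMap.ker π =
      (𝒜 (t - d)).map ψ := by
    intro t
    ext y
    constructor
    · rintro ⟨⟨m, hm, rfl⟩, hy⟩
      have hmN' : m ∈ N' := (Submodule.Quotient.mk_eq_zero N').1 hy
      obtain ⟨n, hn, r, rfl⟩ := hmem.1 hmN'
      refine ⟨_, SetLike.coe_mem (decompose 𝒜 r (t - d)), ?_⟩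
      have hcomp := decompose_of_mem_same ℳ hm
      rw [decompose_add, DirectSum.add_apply, Submodule.coe_add, hdec] at hcomp
      change (decompose 𝒜 r (t - d) : R) • N.mkQ x = N.mkQ (n + r • x)
      rw [← hcomp, map_add, map_smul, Submodule.mkQ_apply, Submodule.mkQ_apply,
        (Submodule.Quotient.mk_eq_zero N).2 (hN t hn), zero_add]
    · rintro ⟨r, hr, rfl⟩
      refine ⟨⟨r • x, ?_, rfl⟩, ?_⟩
      · simpa using hsmul _ _ r x hr hx
      · exact (Submodule.Quotient.mk_eq_zero N').2 (hmem.2 ⟨0, N.zero_mem, r, zero_add _⟩)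
  have hrank : ∀ t, Module.rank K ((ℳ t).map (N.mkQ.restrictScalars K)) =
      Module.rank K ((ℳ t).map (N'.mkQ.restrictScalars K)) +
        Module.rank K ((𝒜 (t - d)).map ψ) := fun t => by
    rw [← hmap, ← hker, Submodule.rank_map_add_rank_inf_ker]
  simp_rw [hrank]
  refine isSemilinearSet_add_le (ih N' hlt hhom) (fun C => ?_) C
  convert (hquot C).vadd d using 1
  ext t
  rw [Set.mem_vadd_set_iff_neg_vadd_mem, vadd_eq_add, neg_add_eq_sub]
  rfl

end Graded

/-- The degree-zero part `R_0` of a `G`-graded `K`-algebra, as a `K`-subalgebra. -/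
def zeroSubalgebra {K G R : Type*} [Field K] [AddCommGroup G] [CommRing R] [Algebra K R]
    (𝒜 : G → Submodule K R) (h1 : (1 : R) ∈ 𝒜 0)
    (hmul : ∀ (g h : G) (a b : R), a ∈ 𝒜 g → b ∈ 𝒜 h → a * b ∈ 𝒜 (g + h)) :
    Subalgebra K R where
  carrier := 𝒜 0
  zero_mem' := (𝒜 0).zero_mem
  one_mem' := h1
  add_mem' {a b} ha hb := (𝒜 0).add_mem ha hb
  mul_mem' {a b} ha hb := by simpa using hmul 0 0 a b ha hb
  algebraMap_mem' k := by
    simpa [Algebra.algebraMap_eq_smul_one] using (𝒜 0).smul_mem k h1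

/-- Theorem: growth of multigraded Hilbert functions.
Let `K` be a field, `G` a finitely generated abelian group, `R` a Noetherian `G`-graded
`K`-algebra with `R_0` a finitely generated `K`-algebra, and `M` a finitely generated
`G`-graded `R`-module.  Let `S` be a finitely generated subsemigroup of `G` containing all
degrees of `R` and `T` a finitely generated `S`-submodule of `G` containing all degrees of
`M`, and let `H(M,t) = dim_K M_t`.  If `H(M, k•c + d) → ∞` for every non-torsion `c ∈ S`
and every `d ∈ T`, then for each `C` only finitely many `t ∈ T` satisfy `H(M,t) ≤ C`. -/
theorem hilbert_function_growth
    (K : Type*) [Field K]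
    {G : Type*} [AddCommGroup G] [AddGroup.FG G] [DecidableEq G]
    {R : Type*} [CommRing R] [Algebra K R] [IsNoetherianRing R]
    (𝒜 : G → Submodule K R)
    (h1 : (1 : R) ∈ 𝒜 0)
    (hmul : ∀ (g h : G) (a b : R), a ∈ 𝒜 g → b ∈ 𝒜 h → a * b ∈ 𝒜 (g + h))
    (hdecomp : DirectSum.IsInternal fun g : G => 𝒜 g)
    (hR0fg : (zeroSubalgebra 𝒜 h1 hmul).FG)
    {M : Type*} [AddCommGroup M] [Module K M] [Module R M] [IsScalarTower K R M]
    [Module.Finite R M]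
    (ℳ : G → Submodule K M)
    (hsmul : ∀ (g h : G) (a : R) (x : M), a ∈ 𝒜 g → x ∈ ℳ h → a • x ∈ ℳ (g + h))
    (hMdecomp : DirectSum.IsInternal fun g : G => ℳ g)
    (S : AddSubmonoid G) (hSfg : S.FG)
    (hdegR : ∀ g : G, g ∉ S → 𝒜 g = ⊥)
    (T : Set G)
    (hTmod : ∀ s ∈ S, ∀ t ∈ T, s + t ∈ T)
    (hTfg : ∃ ts : Finset G, T = ⋃ t ∈ ts, (fun s => s + t) '' (S : Set G))
    (hdegM : ∀ g : G, g ∉ T → ℳ g = ⊥)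
    (hgrowth : ∀ c ∈ S, (∀ k : ℕ, 0 < k → k • c ≠ (0 : G)) → ∀ d ∈ T,
      ∀ n : ℕ, ∃ k₀ : ℕ, ∀ k ≥ k₀, (n : Cardinal) ≤ Module.rank K ↥(ℳ (k • c + d))) :
    ∀ C : ℕ, {t : G | t ∈ T ∧ Module.rank K ↥(ℳ t) ≤ (C : Cardinal)}.Finite := by
  intro C
  have : DirectSum.Decomposition 𝒜 := hdecomp.chooseDecomposition
  have : DirectSum.Decomposition ℳ := hMdecomp.chooseDecomposition
  obtain ⟨ts, hts⟩ := hTfg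
  have hT : IsSemilinearSet T := by
    rw [hts]
    refine .biUnion_finset fun t _ => ?_
    convert (IsSemilinearSet.of_fg hSfg).vadd t using 1
    ext s
    simp only [Set.mem_image, Set.mem_vadd_set, vadd_eq_add, add_comm]
  have hrank : ∀ t, Module.rank K ((ℳ t).map ((⊥ : Submodule R M).mkQ.restrictScalars K)) =
      Module.rank K (ℳ t) := fun t => by
    refine (LinearEquiv.rank_eq (Submodule.equivMapOfInjective _ ?_ (ℳ t))).symm
    exact (Submodule.quotEquivOfEqBot ⊥ rfl).symm.injective
  have hsublevel : IsSemilinearSet {t | Module.rank K (ℳ t) ≤ C} := by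
    simpa only [hrank] using isSemilinearSet_rank_map_mkQ_le 𝒜 ℳ h1 hmul hsmul ⊥
      (fun t m hm => by simp [(Submodule.mem_bot R).1 hm]) C
  by_contra hinf
  obtain ⟨a, c, hc, hray⟩ := (hT.inter hsublevel).exists_ray_of_infinite hinf
  obtain ⟨m, hm, hmS⟩ := hSfg.exists_nsmul_mem_of_ray (ts := ts) (a := a) (c := c) fun k => by
    have hk := (hray k).1
    rw [hts] at hk
    simp only [Set.mem_iUnion, exists_prop] at hk
    obtain ⟨t, ht, s, hs, hst⟩ := hk
    exact ⟨t, ht, by rw [← hst]; simpa using hs⟩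
  obtain ⟨k₀, hk₀⟩ := hgrowth (m • c) hmS
    (fun k hk h => hc (k * m) (Nat.mul_pos hk hm) (by rwa [mul_nsmul'])) a
    (by simpa using (hray 0).1) (C + 1)
  have hlarge := hk₀ k₀ le_rfl
  have hsmall := (hray (k₀ * m)).2
  rw [Set.mem_ofPred_eq, mul_nsmul'] at hsmall
  have := hlarge.trans hsmall
  norm_cast at this
  omega
end
end

section
/- Let G be a finitely generated abelian group, S a finitely generated subsemigroup of G, and T a finitely generated S-submodule of G. For i = 1,…,v let A_i be an affine semigroup, φ_i : A_i → S a semigroup homomorphism, t_i ∈ T, and define ψ_i : A_i → T by ψ_i(x) = φ_i(x) + t_i. For t ∈ G set H(t) = Σ_{i=1}^v #{x ∈ A_i : ψ_i(x) = t}, the number of preimages of t under the map Ψ induced by the ψ_i on the disjoint union of the A_i. Suppose that lim_{k→∞} H(kc + d) = ∞ for every c ∈ S that is not a torsion element of G and every d ∈ T. Then for every C ∈ ℤ_+ the set {t ∈ T : H(t) ≤ C} is finite. -/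
set_option synthInstance.maxHeartbeats 1000000
set_option maxHeartbeats 1000000

open scoped BigOperators

noncomputable section

/-- The counting function `H(g)`: the total number of preimages of `g` under the maps
`ψ_i = φ_i + t_i` on the disjoint union of the semigroups `A_i`. -/
def countPreimages {G : Type*} [AddCommGroup G] {v : ℕ} {n : Fin v → ℕ}
    (A : ∀ i, AddSubmonoid (Fin (n i) → ℤ)) (φ : ∀ i, (Fin (n i) → ℤ) → G)
    (t : Fin v → G) (g : G) : ℕ∞ :=
  ∑ i, Set.encard {x : Fin (n i) → ℤ | x ∈ A i ∧ φ i x + t i = g}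

/-- The set of points with at least `m` preimages under an additive homomorphism from a finitely
generated monoid is semilinear. -/
theorem isSemilinearSet_le_encard_fiber {M G : Type*} [AddCommMonoid M] [AddMonoid.FG M]
    [AddCommGroup G] [AddMonoid.FG G] (f : M →+ G) (m : ℕ) :
    IsSemilinearSet {g : G | (m : ℕ∞) ≤ {x : M | f x = g}.encard} := by
  let X : Set ((Fin m → M) × G) :=
    (⋂ j : Fin m, {p | f (p.1 j) = p.2}) ∩
      ⋂ q : {q : Fin m × Fin m // q.1 ≠ q.2}, {p | p.1 q.1.1 = p.1 q.1.2}ᶜ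
  have hX : IsSemilinearSet X := by
    refine (IsSemilinearSet.iInter fun j => ?_).inter
      (IsSemilinearSet.iInter fun q => IsSemilinearSet.compl ?_)
    · simpa using isSemilinearSet_setOfPred_eq 0 0
        (f.comp ((Pi.evalAddMonoidHom (fun _ : Fin m => M) j).comp
          (AddMonoidHom.fst (Fin m → M) G))) (AddMonoidHom.snd (Fin m → M) G)
    · simpa using isSemilinearSet_setOfPred_eq 0 0
        ((Pi.evalAddMonoidHom (fun _ : Fin m => M) q.1.1).comp
          (AddMonoidHom.fst (Fin m → M) G))
        ((Pi.evalAddMonoidHom (fun _ : Fin m => M) q.1.2).comp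
          (AddMonoidHom.fst (Fin m → M) G))
  convert hX.image (AddMonoidHom.snd (Fin m → M) G) using 1
  ext g
  simp only [Set.mem_ofPred_eq, Set.mem_image, Prod.exists, AddMonoidHom.coe_snd, X,
    Set.mem_inter_iff, Set.mem_iInter, Set.mem_compl_iff, Subtype.forall, Prod.forall]
  constructor
  · intro h
    obtain ⟨s, hs, hcard⟩ := Set.exists_subset_encard_eq h
    have hfin : s.Finite := Set.finite_of_encard_eq_coe hcard
    have : Fintype s := hfin.fintype
    have hc : Fintype.card s = m := by
      rw [Set.encard_eq_coe_toFinset_card, Set.toFinset_card] at hcard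
      exact_mod_cast hcard
    let e := (Fintype.equivFinOfCardEq hc).symm
    exact ⟨fun j => e j, g, ⟨fun j => hs (e j).2,
      fun a b hab h => hab (e.injective (Subtype.ext h))⟩, rfl⟩
  · rintro ⟨x, g', ⟨hx, hne⟩, rfl⟩
    have hinj : Function.Injective x := fun a b hab => by
      by_contra h
      exact hne a b h hab
    calc (m : ℕ∞) = (Set.range x).encard := by
          rw [← Set.image_univ, hinj.encard_image, Set.encard_univ, ENat.card_eq_coe_fintype_card,
            Fintype.card_fin]
      _ ≤ _ := Set.encard_le_encard (Set.range_subset_iff.2 hx)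

theorem ENat.natCast_le_add_iff {N : ℕ} {a b : ℕ∞} :
    (N : ℕ∞) ≤ a + b ↔ ∃ k : Fin (N + 1), ((k : ℕ) : ℕ∞) ≤ a ∧ ((N - k : ℕ) : ℕ∞) ≤ b := by
  constructor
  · intro h
    rcases le_total (N : ℕ∞) a with ha | ha
    · exact ⟨⟨N, by omega⟩, by simpa using ha, by simp⟩
    · lift a to ℕ using ne_top_of_le_ne_top (ENat.natCast_ne_top N) ha
      have ha' : a ≤ N := by exact_mod_cast ha
      refine ⟨⟨a, by omega⟩, le_rfl, ?_⟩
      cases b with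
      | top => simp
      | coe b =>
        norm_cast at h ⊢
        simp only
        omega
  · rintro ⟨k, ha, hb⟩
    calc (N : ℕ∞) = ((k : ℕ) : ℕ∞) + ((N - k : ℕ) : ℕ∞) := by
          norm_cast
          omega
      _ ≤ a + b := add_le_add ha hb

/-- If all superlevel sets of finitely many functions are semilinear, so are those of their sum. -/
theorem isSemilinearSet_le_sum {G ι : Type*} [AddCommMonoid G] [AddMonoid.FG G] (s : Finset ι)
    (F : ι → G → ℕ∞) (hF : ∀ i ∈ s, ∀ N : ℕ, IsSemilinearSet {g | (N : ℕ∞) ≤ F i g}) (N : ℕ) :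
    IsSemilinearSet {g | (N : ℕ∞) ≤ ∑ i ∈ s, F i g} := by
  classical
  induction s using Finset.induction_on generalizing N with
  | empty =>
    rcases N with - | N
    · simp
    · convert IsSemilinearSet.empty (M := G)
      simp
  | insert i s his ih =>
    simp only [Finset.sum_insert his, ENat.natCast_le_add_iff, Set.ofPred_exists, Set.ofPred_and]
    exact .iUnion fun k => (hF i (s.mem_insert_self i) _).inter
      (ih (fun j hj => hF j (Finset.mem_insert_of_mem hj)) _)

open Pointwise in
/-- The superlevel sets of the counting function are semilinear. -/
theorem isSemilinearSet_le_countPreimages {G : Type*} [AddCommGroup G] [AddMonoid.FG G]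
    {v : ℕ} {n : Fin v → ℕ} (A : ∀ i, AddSubmonoid (Fin (n i) → ℤ)) (hAfg : ∀ i, (A i).FG)
    (φ : ∀ i, (Fin (n i) → ℤ) → G) (hφ0 : ∀ i, φ i 0 = 0)
    (hφadd : ∀ i, ∀ x ∈ A i, ∀ y ∈ A i, φ i (x + y) = φ i x + φ i y)
    (t : Fin v → G) (N : ℕ) :
    IsSemilinearSet {g | (N : ℕ∞) ≤ countPreimages A φ t g} := by
  refine isSemilinearSet_le_sum _ _ (fun i _ m => ?_) N
  let f : A i →+ G :=
    { toFun := fun x => φ i x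
      map_zero' := hφ0 i
      map_add' := fun x y => hφadd i x x.2 y y.2 }
  have : AddMonoid.FG (A i) := (AddMonoid.fg_iff_addSubmonoid_fg _).2 (hAfg i)
  convert (isSemilinearSet_le_encard_fiber f m).vadd (t i) using 1
  ext g
  rw [Set.mem_vadd_set_iff_neg_vadd_mem, Set.mem_ofPred_eq, Set.mem_ofPred_eq,
    ← Subtype.val_injective.encard_image]
  congr! 2
  ext x
  simp [f, eq_add_neg_iff_add_eq, and_comm, add_comm (-t i)]

/-- An infinite semilinear set in an abelian group contains a ray whose direction is
non-torsion. -/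
theorem IsSemilinearSet.exists_ray {G : Type*} [AddCommGroup G] {E : Set G}
    (hE : IsSemilinearSet E) (hinf : E.Infinite) :
    ∃ a p : G, ¬ IsOfFinAddOrder p ∧ ∀ k : ℕ, a + k • p ∈ E := by
  obtain ⟨L, hL, hlin, rfl⟩ := hE
  obtain ⟨l, hl, hlinf⟩ : ∃ l ∈ L, l.Infinite := by
    by_contra! h
    exact hinf (hL.sUnion fun l hl => h l hl)
  obtain ⟨a, P, hP, rfl⟩ := hlin l hl
  by_contra! h
  refine hlinf (Set.Finite.vadd_set ?_)
  have htors : ∀ p ∈ P, IsOfFinAddOrder p := fun p hp => by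
    by_contra hp'
    obtain ⟨k, hk⟩ := h a p hp'
    exact hk ⟨_, hl, _, nsmul_mem (AddSubmonoid.subset_closure hp) k, rfl⟩
  have : Finite P := hP
  have hle : AddSubgroup.closure P ≤ AddCommGroup.torsion G := (AddSubgroup.closure_le _).2 htors
  have hfin : Finite (AddSubgroup.closure P) :=
    AddCommGroup.finite_of_fg_isAddTorsion _ fun x => by
      rw [← AddSubmonoid.isOfFinAddOrder_coe]
      exact hle x.2
  exact Set.Finite.subset (s := (AddSubgroup.closure P : Set G)) hfin
    (AddSubgroup.le_closure_toAddSubmonoid P)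

/-- If a ray is contained in finitely many translates of a finitely generated monoid `S`, then a
positive multiple of its direction lies in `S`. -/
theorem AddSubmonoid.FG.exists_nsmul_mem {G : Type*} [AddCommGroup G] {S : AddSubmonoid G}
    (hS : S.FG) (ts : Finset G) {a p : G}
    (h : ∀ k : ℕ, ∃ u ∈ ts, ∃ s ∈ S, s + u = a + k • p) : ∃ m : ℕ, 0 < m ∧ m • p ∈ S := by
  obtain ⟨r, f, rfl⟩ := AddSubmonoid.fg_iff_exists_fin_addMonoidHom.1 hS
  choose u hu s hs hsu using h
  choose x hx using hs
  have hwqo := (wellQuasiOrdered_le (α := Fin r → ℕ)).prod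
    (Finite.wellQuasiOrdered (α := ts) (· = ·))
  obtain ⟨k, l, hkl, hxle, hueq⟩ := hwqo fun k => (x k, ⟨u k, hu k⟩)
  have hueq : u k = u l := congrArg Subtype.val hueq
  obtain ⟨y, hy⟩ := exists_add_of_le hxle
  refine ⟨l - k, by omega, y, ?_⟩
  have hy : s l = s k + f y := by rw [← hx, ← hx, ← map_add]; exact congrArg f hy
  have h1 := hsu l
  rw [← Nat.sub_add_cancel hkl.le, add_nsmul, add_comm ((l - k) • p), ← add_assoc, ← hsu k,
    Nat.sub_add_cancel hkl.le, hy, hueq] at h1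
  have : f y + (s k + u l) = (l - k) • p + (s k + u l) := by
    rw [add_comm _ (s k + u l), add_comm _ (s k + u l), ← h1]; abel
  exact add_right_cancel this

/-- Theorem: combinatorial growth of Hilbert functions.
Let `G` be a finitely generated abelian group, `S` a finitely generated subsemigroup,
`T` a finitely generated `S`-submodule of `G`, `A_i` affine semigroups, `φ_i : A_i → S`
semigroup homomorphisms, `t_i ∈ T`, and `H(g)` the number of preimages of `g` under the
induced map `Ψ` on the disjoint union of the `A_i`.  If `H(k•c + d) → ∞` for every
non-torsion `c ∈ S` and every `d ∈ T`, then for each `C ∈ ℤ_+` only finitely many `t ∈ T`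
satisfy `H(t) ≤ C`. -/
theorem combinatorial_hilbert_growth
    {G : Type*} [AddCommGroup G] [AddGroup.FG G]
    (S : AddSubmonoid G) (hSfg : S.FG)
    (T : Set G)
    (hTmod : ∀ s ∈ S, ∀ t ∈ T, s + t ∈ T)
    (hTfg : ∃ ts : Finset G, T = ⋃ t ∈ ts, (fun s => s + t) '' (S : Set G))
    {v : ℕ} {n : Fin v → ℕ}
    (A : ∀ i, AddSubmonoid (Fin (n i) → ℤ)) (hAfg : ∀ i, (A i).FG)
    (φ : ∀ i, (Fin (n i) → ℤ) → G)
    (hφ0 : ∀ i, φ i 0 = 0)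
    (hφadd : ∀ i, ∀ x ∈ A i, ∀ y ∈ A i, φ i (x + y) = φ i x + φ i y)
    (hφS : ∀ i, ∀ x ∈ A i, φ i x ∈ S)
    (t : Fin v → G) (ht : ∀ i, t i ∈ T)
    (hgrowth : ∀ c ∈ S, (∀ k : ℕ, 0 < k → k • c ≠ (0 : G)) → ∀ d ∈ T, ∀ N : ℕ,
      ∃ k₀ : ℕ, ∀ k ≥ k₀, (N : ℕ∞) ≤ countPreimages A φ t (k • c + d)) :
    ∀ C : ℕ, {g : G | g ∈ T ∧ countPreimages A φ t g ≤ (C : ℕ∞)}.Finite := by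
  intro C
  obtain ⟨ts, hts⟩ := hTfg
  have hT : IsSemilinearSet T := by
    rw [hts]
    refine .biUnion_finset fun u _ => ?_
    convert (IsSemilinearSet.of_fg hSfg).vadd u using 1
    exact Set.image_congr fun s _ => add_comm s u
  have hE := hT.inter (isSemilinearSet_le_countPreimages A hAfg φ hφ0 hφadd t (C + 1)).compl
  by_contra hinf
  obtain ⟨a, p, hp, hray⟩ := hE.exists_ray (hinf <| ·.subset fun g hg =>
    ⟨hg.1, fun h => absurd (h.trans hg.2) (by norm_cast; omega)⟩)
  obtain ⟨m, hm, hmS⟩ := hSfg.exists_nsmul_mem ts (a := a) (p := p) fun k => by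
    have h := (hray k).1
    rw [hts] at h
    simpa only [Set.mem_iUnion, Set.mem_image, exists_prop, SetLike.mem_coe] using h
  obtain ⟨k, hk⟩ := hgrowth (m • p) hmS
    (fun j hj h => hp (isOfFinAddOrder_iff_nsmul_eq_zero.2
      ⟨j * m, by positivity, by rw [mul_nsmul', h]⟩))
    a (by simpa using (hray 0).1) (C + 1)
  refine (hray (k * m)).2 ?_
  have := hk k le_rfl
  rwa [← mul_nsmul', add_comm _ a] at this
end
end
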